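/- Fix p,β∈ℕ+, ε∈(0,1), and d ≥ 1+17·β^{p+1}·3^p·p. Let Θ be any transformer parameters with the emulation property. Then there exist a constant C>0 depending only on β, p and d, and a universal constant c_L>0, such that for every L∈ℕ+ with L ≥ c_L·(p+β²+(p/β)·ε^{−p/(2β)}·log(1/ε)) and every T ≥ 2dL: sup_{f∈C_u^β([0,1]^p)} inf_{S>0, H^P∈Q_{ℝ^d}(T,L,S)} ‖f̂_{Θ,H^P,L,p} − f‖_{L^∞([0,1]^p)} ≤ C·ε. -/

import Mathlib

open scoped BigOperators
open Matrix

noncomputable section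

namespace PromptTF

/-- The ReLU activation function. -/
def relu (x : ℝ) : ℝ := max x 0

/-- The elementary universal activation function (EUAF). -/
def euaf (x : ℝ) : ℝ :=
  if 0 ≤ x then |x - 2 * (⌊(x + 1) / 2⌋ : ℝ)| else x / (1 + |x|)

/-- Parameters of one transformer layer (attention heads and a feed-forward net). -/
structure TFLayer (D : ℕ) where
  M : ℕ
  Q : Fin M → Matrix (Fin D) (Fin D) ℝ
  K : Fin M → Matrix (Fin D) (Fin D) ℝ
  V : Fin M → Matrix (Fin D) (Fin D) ℝ
  width : ℕ
  W1 : Matrix (Fin width) (Fin D) ℝ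
  W2 : Matrix (Fin D) (Fin width) ℝ

/-- Self-attention layer applied to a list of tokens. -/
def attnOut {D : ℕ} (θ : TFLayer D) (H : List (Fin D → ℝ)) : List (Fin D → ℝ) :=
  H.map fun h => fun i =>
    h i + ∑ m : Fin θ.M,
      (H.map fun h' =>
        relu (dotProduct ((θ.Q m).mulVec h) ((θ.K m).mulVec h')) * ((θ.V m).mulVec h') i).sum

/-- One transformer layer `FFN ∘ Attn`, with feed-forward activation `act`. -/
def layerMap {D : ℕ} (act : ℝ → ℝ) (θ : TFLayer D) (H : List (Fin D → ℝ)) :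
    List (Fin D → ℝ) :=
  (attnOut θ H).map fun h => fun i =>
    h i + (θ.W2.mulVec fun k => act ((θ.W1.mulVec h) k)) i

/-- Multi-layer transformer, all activations ReLU. -/
def tfForward {D : ℕ} (Θ : List (TFLayer D)) (H : List (Fin D → ℝ)) : List (Fin D → ℝ) :=
  Θ.foldl (fun H' θ => layerMap relu θ H') H

/-- Multi-layer transformer whose first feed-forward layer uses the EUAF activation. -/
def tfForwardEUAF {D : ℕ} (Θ : List (TFLayer D)) (H : List (Fin D → ℝ)) :
    List (Fin D → ℝ) :=
  match Θ with
  | [] => H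
  | θ :: rest => rest.foldl (fun H' θ' => layerMap relu θ' H') (layerMap euaf θ H)

/-- Sequential (autoregressive) generation: append the last output column repeatedly. -/
def genTokens {D : ℕ} (forward : List (Fin D → ℝ) → List (Fin D → ℝ))
    (H : List (Fin D → ℝ)) : ℕ → List (Fin D → ℝ)
  | 0 => H
  | v + 1 =>
      genTokens forward H v ++ [(forward (genTokens forward H v)).getLastD (fun _ => 0)]

/-- The token at one-based position `m` in the generated sequence. -/
def tokenAt {D : ℕ} (forward : List (Fin D → ℝ) → List (Fin D → ℝ))
    (H : List (Fin D → ℝ)) (m : ℕ) : Fin D → ℝ :=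
  (genTokens forward H (m - H.length)).getD (m - 1) (fun _ => 0)

/-- A token with word embedding `u`, layer index `w`, position `j` and scale `S`:
`(uᵀ, 0_{3d+4}ᵀ, 1, S, S·w, S·j)ᵀ ∈ ℝ^{4d+8}`. -/
def promptToken (d : ℕ) (u : Fin d → ℝ) (w : ℤ) (j : ℕ) (S : ℝ) : Fin (4 * d + 8) → ℝ :=
  fun i =>
    if h : (i : ℕ) < d then u ⟨i, h⟩
    else if (i : ℕ) = 4 * d + 4 then 1
    else if (i : ℕ) = 4 * d + 5 then S
    else if (i : ℕ) = 4 * d + 6 then S * w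
    else if (i : ℕ) = 4 * d + 7 then S * j
    else 0

/-- First `d` coordinates of a token. -/
def firstd (d : ℕ) (h : Fin (4 * d + 8) → ℝ) : Fin d → ℝ :=
  fun k => h (Fin.castLE (by omega) k)

/-- Initial input: `T` prompt tokens followed by `N` data tokens. -/
def initialInput (d T N : ℕ) (u : Fin T → Fin d → ℝ) (w : Fin T → ℕ) (S : ℝ)
    (z : Fin N → Fin d → ℝ) : List (Fin (4 * d + 8) → ℝ) :=
  ((List.finRange T).map fun j => promptToken d (u j) (w j) ((j : ℕ) + 1) S)
    ++ ((List.finRange N).map fun i => promptToken d (z i) 0 (T + (i : ℕ) + 1) S)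

/-- The closed Euclidean ball of radius `B` in `ℝ^d`. -/
def eball (d : ℕ) (B : ℝ) : Set (Fin d → ℝ) :=
  {v | Real.sqrt (∑ k, v k ^ 2) ≤ B}

/-- Data of a valid prompt in `P_U(T, L, S)`: word embeddings in `U`,
layer indices in `{1, …, 2L}`. -/
def ValidPrompt {d : ℕ} (U : Set (Fin d → ℝ)) (T L : ℕ)
    (u : Fin T → Fin d → ℝ) (w : Fin T → ℕ) : Prop :=
  (∀ j, u j ∈ U) ∧ ∀ j, 1 ≤ w j ∧ w j ≤ 2 * L

/-- The virtual weight matrix `W^P_ℓ` (without the first-layer correction term). -/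
def WPmat {d T : ℕ} (u : Fin T → Fin d → ℝ) (w : Fin T → ℕ) (ℓ : ℕ) :
    Matrix (Fin d) (Fin d) ℝ :=
  ∑ j : Fin T,
    if h : (j : ℕ) + 1 < T then
      (if w j = 2 * ℓ - 1 ∧ w ⟨(j : ℕ) + 1, h⟩ = 2 * ℓ then
        vecMulVec (u j) (u ⟨(j : ℕ) + 1, h⟩) else 0)
    else 0

/-- The first-layer correction term `(h_T)_{1:d} 1{w_T=1} Σ_{j'} (h_{j'})_{1:d}ᵀ 1{w_{j'}=1}`. -/
def WPcorr {d T : ℕ} (u : Fin T → Fin d → ℝ) (w : Fin T → ℕ) :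
    Matrix (Fin d) (Fin d) ℝ :=
  if hT : 0 < T then
    (if w ⟨T - 1, by omega⟩ = 1 then
      vecMulVec (u ⟨T - 1, by omega⟩) (∑ j : Fin T, if w j = 1 then u j else 0)
    else 0)
  else 0

/-- The virtual first-layer weight matrix `W^P_{1,i}`; `first` indicates `i = 1`. -/
def WPone {d T : ℕ} (u : Fin T → Fin d → ℝ) (w : Fin T → ℕ) (first : Bool) :
    Matrix (Fin d) (Fin d) ℝ :=
  WPmat u w 1 + if first then WPcorr u w else 0

/-- The family of virtual weight matrices of a prompt, for the data token with
zero-based index `i`. -/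
def WPfam {d T : ℕ} (u : Fin T → Fin d → ℝ) (w : Fin T → ℕ) (i : ℕ) :
    ℕ → Matrix (Fin d) (Fin d) ℝ :=
  fun ℓ => if ℓ = 1 then WPone u w (i == 0) else WPmat u w ℓ

/-- Output of the virtual network after `ℓ` layers:
`vnetOut … ℓ = W_ℓ act(W_{ℓ-1} act( ⋯ act(W_1 z) ⋯ ))`. -/
def vnetOut (d : ℕ) (act : ℝ → ℝ) (Ws : ℕ → Matrix (Fin d) (Fin d) ℝ)
    (z : Fin d → ℝ) : ℕ → Fin d → ℝ
  | 0 => z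
  | ℓ + 1 =>
      (Ws (ℓ + 1)).mulVec fun k =>
        if ℓ = 0 then vnetOut d act Ws z ℓ k else act (vnetOut d act Ws z ℓ k)

/-- The emulation property: for every admissible prompt and data tokens, the sequentially
generated tokens realize the virtual neural network encoded by the prompt
(with activation `act`). -/
def EmulatesWith (d : ℕ)
    (forward : List (Fin (4 * d + 8) → ℝ) → List (Fin (4 * d + 8) → ℝ))
    (act : ℝ → ℝ) : Prop :=
  ∀ B : ℝ, 1 ≤ B → ∀ T L : ℕ, 0 < T → 0 < L →
  ∀ U : Set (Fin d → ℝ), U ⊆ eball d B →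
  ∀ S : ℝ, max ((d : ℝ) * B ^ (4 * L) * (T : ℝ) ^ (2 * L)) (2 * (L : ℝ)) ≤ S →
  ∀ (u : Fin T → Fin d → ℝ) (w : Fin T → ℕ), ValidPrompt U T L u w →
  ∀ N : ℕ, 0 < N → ∀ z : Fin N → Fin d → ℝ, (∀ i k, z i k ∈ Set.Icc (0 : ℝ) 1) →
  ∀ (i : Fin N) (ℓ : ℕ), 1 ≤ ℓ → ℓ ≤ L →
    tokenAt forward (initialInput d T N u w S z) (T + N * ℓ + (i : ℕ) + 1)
      = promptToken d (vnetOut d act (WPfam u w (i : ℕ)) (z i) ℓ) (-(ℓ : ℤ))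
          (T + N * ℓ + (i : ℕ) + 1) S

/-- The embedding `x ↦ (xᵀ, 1, 0_{d-p-1}ᵀ)ᵀ ∈ ℝ^d` of an input `x ∈ ℝ^p`. -/
def embed (d p : ℕ) (x : Fin p → ℝ) : Fin d → ℝ :=
  fun k => if h : (k : ℕ) < p then x ⟨k, h⟩ else if (k : ℕ) = p then 1 else 0

/-- The function approximator `f̂_{Θ,H^P,L,p}`: first coordinate of the token at
position `T+1+L` generated from the prompt followed by the single data token. -/
def fhat {d : ℕ} (forward : List (Fin (4 * d + 8) → ℝ) → List (Fin (4 * d + 8) → ℝ))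
    {T : ℕ} (u : Fin T → Fin d → ℝ) (w : Fin T → ℕ) (S : ℝ) (L p : ℕ)
    (x : Fin p → ℝ) : ℝ :=
  tokenAt forward (initialInput d T 1 u w S fun _ => embed d p x) (T + 1 + L)
    ⟨0, by omega⟩

/-- The unit cube `[0,1]^p`. -/
def unitCube (p : ℕ) : Set (Fin p → ℝ) := Set.Icc 0 1

/-- The sup-distance `‖f - g‖_{L^∞([0,1]^p)}`. -/
def supDist (p : ℕ) (f g : (Fin p → ℝ) → ℝ) : ℝ :=
  ⨆ x : unitCube p, |f x.1 - g x.1|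

/-- Partial derivative (within the unit cube) in coordinate direction `i`. -/
def pderivW (p : ℕ) (i : Fin p) (f : (Fin p → ℝ) → ℝ) : (Fin p → ℝ) → ℝ :=
  fun x => fderivWithin ℝ f (unitCube p) x (Pi.single i 1)

/-- Iterated partial derivative along a list of coordinate directions. -/
def pderivList (p : ℕ) : List (Fin p) → ((Fin p → ℝ) → ℝ) → (Fin p → ℝ) → ℝ
  | [], f => f
  | i :: is, f => pderivList p is (pderivW p i f)

/-- The unit ball `C_u^β([0,1]^p)` of `β`-times continuously differentiable functions with
all partial derivatives of order `≤ β` bounded by `1` on the cube. -/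
def Hclass (p β : ℕ) : Set ((Fin p → ℝ) → ℝ) :=
  {f | ContDiffOn ℝ β f (unitCube p) ∧
    ∀ ls : List (Fin p), ls.length ≤ β →
      ∀ x ∈ unitCube p, |pderivList p ls f x| ≤ 1}

/-- `U_{d,r}` : the span of the first `r` standard basis vectors of `ℝ^d`. -/
def spanFirst (d r : ℕ) : Set (Fin d → ℝ) :=
  {v | ∀ k : Fin d, r ≤ (k : ℕ) → v k = 0}

/-- Hidden layers of a standard ReLU network of width `r` (with biases). -/
def nnHidden {p r : ℕ} (W0 : Matrix (Fin r) (Fin p) ℝ) (b0 : Fin r → ℝ)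
    (Wm : ℕ → Matrix (Fin r) (Fin r) ℝ) (bm : ℕ → Fin r → ℝ) (x : Fin p → ℝ) :
    ℕ → Fin r → ℝ
  | 0 => fun i => W0.mulVec x i + b0 i
  | k + 1 => fun i =>
      (Wm k).mulVec (fun j => relu (nnHidden W0 b0 Wm bm x k j)) i + bm k i

/-- The class `N(r,p,L)` of ReLU networks `ℝ^p → ℝ` of width `r` and depth `L`
(`L` affine maps with ReLU in between). -/
def NNclass (r p L : ℕ) : Set ((Fin p → ℝ) → ℝ) :=
  {f | if L = 1 then ∃ (a : Fin p → ℝ) (b : ℝ), f = fun x => (∑ i, a i * x i) + b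
    else ∃ (W0 : Matrix (Fin r) (Fin p) ℝ) (b0 : Fin r → ℝ)
      (Wm : ℕ → Matrix (Fin r) (Fin r) ℝ) (bm : ℕ → Fin r → ℝ)
      (wL : Fin r → ℝ) (bL : ℝ),
      f = fun x => (∑ j, wL j * relu (nnHidden W0 b0 Wm bm x (L - 2) j)) + bL}

/-- Operator norm (w.r.t. the Euclidean norm) of a `d × d` matrix. -/
def opNorm {d : ℕ} (W : Matrix (Fin d) (Fin d) ℝ) : ℝ :=
  ‖LinearMap.toContinuousLinearMap (Matrix.toEuclideanLin W)‖

/-- The class `W(r,d,U,B)` of coarse weight matrices. -/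
def coarseW (d r : ℕ) (U : Set (Fin d → ℝ)) (B : ℝ) :
    Set (Matrix (Fin d) (Fin d) ℝ) :=
  {W | (∃ ut uu : Fin r → Fin d → ℝ,
        (∀ k, ut k ∈ U) ∧ (∀ k, uu k ∈ U) ∧ W = ∑ k, vecMulVec (ut k) (uu k)) ∧
    opNorm W ≤ B ^ 2}

open Classical in
/-- Number of nonzero parameter entries of one transformer layer. -/
def layerNonzero {D : ℕ} (θ : TFLayer D) : ℕ :=
  (Finset.univ.filter fun p : Fin θ.M × Fin D × Fin D => θ.Q p.1 p.2.1 p.2.2 ≠ 0).card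
  + (Finset.univ.filter fun p : Fin θ.M × Fin D × Fin D => θ.K p.1 p.2.1 p.2.2 ≠ 0).card
  + (Finset.univ.filter fun p : Fin θ.M × Fin D × Fin D => θ.V p.1 p.2.1 p.2.2 ≠ 0).card
  + (Finset.univ.filter fun p : Fin θ.width × Fin D => θ.W1 p.1 p.2 ≠ 0).card
  + (Finset.univ.filter fun p : Fin D × Fin θ.width => θ.W2 p.1 p.2 ≠ 0).card

/-- Total number of nonzero parameter entries of a transformer. -/
def tfNonzero {D : ℕ} (Θ : List (TFLayer D)) : ℕ := (Θ.map layerNonzero).sum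

/-- All parameter entries of one layer bounded in absolute value by `c`. -/
def layerEntriesBounded {D : ℕ} (θ : TFLayer D) (c : ℝ) : Prop :=
  (∀ m i j, |θ.Q m i j| ≤ c) ∧ (∀ m i j, |θ.K m i j| ≤ c) ∧ (∀ m i j, |θ.V m i j| ≤ c)
  ∧ (∀ i j, |θ.W1 i j| ≤ c) ∧ ∀ i j, |θ.W2 i j| ≤ c

end PromptTF
end

open PromptTF Matrix

noncomputable section

namespace PromptTF

lemma relu_nonneg (x : ℝ) : 0 ≤ relu x := le_max_right _ _
lemma relu_of_nonneg {x : ℝ} (h : 0 ≤ x) : relu x = x := max_eq_left h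
lemma relu_of_nonpos {x : ℝ} (h : x ≤ 0) : relu x = 0 := max_eq_right h

/-- From registers holding the functions in `A`, one ReLU layer of width at most `W` produces
registers holding the functions in `B`. -/
def LayerReach {X : Type} (W : ℕ) (A B : Set (X → ℝ)) : Prop :=
  B.encard ≤ W ∧ ∀ b ∈ B, ∃ g ∈ Submodule.span ℝ A, b = fun x => relu (g x)

/-- `n` consecutive ReLU layers of width at most `W` lead from `A` to `B`. -/
def Reach {X : Type} (W : ℕ) : ℕ → Set (X → ℝ) → Set (X → ℝ) → Prop
  | 0, A, B => B ⊆ A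
  | n + 1, A, B => ∃ C, Reach W n A C ∧ LayerReach W C B

namespace Reach
variable {X : Type} {W W' n n' : ℕ} {A A' B B' C : Set (X → ℝ)}

lemma nonneg (hA : ∀ a ∈ A, 0 ≤ a) (h : Reach W n A B) : ∀ b ∈ B, 0 ≤ b := by
  cases n with
  | zero => exact fun b hb => hA b (h hb)
  | succ n =>
    obtain ⟨C, -, -, h⟩ := h
    intro b hb
    obtain ⟨g, -, rfl⟩ := h b hb
    exact fun x => relu_nonneg _

lemma mono_right (hB : B' ⊆ B) (h : Reach W n A B) : Reach W n A B' := by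
  cases n with
  | zero => exact hB.trans h
  | succ n =>
    obtain ⟨C, h1, h2, h3⟩ := h
    exact ⟨C, h1, (Set.encard_le_encard hB).trans h2, fun b hb => h3 b (hB hb)⟩

lemma mono_width (hW : W ≤ W') (h : Reach W n A B) : Reach W' n A B := by
  induction n generalizing B with
  | zero => exact h
  | succ n ih =>
    obtain ⟨C, h1, h2, h3⟩ := h
    exact ⟨C, ih h1, h2.trans (by exact_mod_cast hW), h3⟩

lemma trans (h : Reach W n A B) (h' : Reach W n' B C) : Reach W (n + n') A C := by
  induction n' generalizing C with
  | zero => exact h.mono_right h'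
  | succ n' ih =>
    obtain ⟨D, h1, h2⟩ := h'
    exact ⟨D, ih h1, h2⟩

lemma succ (hA : ∀ a ∈ A, 0 ≤ a) (hB : B.encard ≤ W) (h : Reach W n A B) :
    Reach W (n + 1) A B :=
  ⟨B, h, hB, fun b hb => ⟨b, Submodule.subset_span hb,
    funext fun x => (relu_of_nonneg (h.nonneg hA b hb x)).symm⟩⟩

lemma mono_length (hA : ∀ a ∈ A, 0 ≤ a) (hB : B.encard ≤ W) (hn : n ≤ n')
    (h : Reach W n A B) : Reach W n' A B := by
  induction hn with
  | refl => exact h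
  | step _ ih => exact ih.succ hA hB

end Reach

/-- Keeping any registers whose contents are nonnegative and include `E`, the functions in `F` can
be computed by `n` ReLU layers with `w` additional registers. -/
def Computes {X : Type} (n w : ℕ) (E F : Set (X → ℝ)) : Prop :=
  ∀ (G : Set (X → ℝ)) (k : ℕ), (∀ g ∈ G, 0 ≤ g) → E ⊆ G → G.encard ≤ k →
    Reach (k + w) n G (G ∪ F)

namespace Computes
variable {X : Type} {n n' n₁ n₂ w w' w₁ w₂ c : ℕ} {E E' F F' : Set (X → ℝ)}

lemma mono (h : Computes n w E F) (hn : n ≤ n') (hw : w ≤ w') (hE : E ⊆ E') (hF : F' ⊆ F) :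
    Computes n' w' E' F' := by
  intro G k hG hEG hk
  have h1 := h G k hG (hE.trans hEG) hk
  refine ((h1.mono_length hG ?_ hn).mono_right ?_).mono_width (by omega)
  · cases n with
    | zero => exact (Set.encard_le_encard h1).trans (hk.trans (by exact_mod_cast (by omega)))
    | succ n => exact h1.choose_spec.2.1
  · exact Set.union_subset_union_right _ hF

lemma bind (h₁ : Computes n₁ w₁ E F) (hF : F.encard ≤ c) (h₂ : Computes n₂ w₂ (E ∪ F) F')
    (hw₁ : w₁ ≤ w) (hw₂ : c + w₂ ≤ w) (hn : n₁ + n₂ ≤ n) : Computes n w E (F ∪ F') := by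
  suffices Computes (n₁ + n₂) w E (F ∪ F') from this.mono hn le_rfl subset_rfl subset_rfl
  intro G k hG hEG hk
  have r₁ := (h₁ G k hG hEG hk).mono_width (W' := k + w) (by omega)
  have r₂ := h₂ (G ∪ F) (k + c) (r₁.nonneg hG) (Set.union_subset_union_left _ hEG)
    ((Set.encard_union_le _ _).trans (by push_cast; exact add_le_add hk hF))
  rw [← Set.union_assoc]
  exact r₁.trans (r₂.mono_width (by omega))

lemma bind_one {f : X → ℝ} (h₁ : Computes n₁ w₁ E {f}) (h₂ : Computes n₂ w₂ (insert f E) F')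
    (hw₁ : w₁ ≤ w) (hw₂ : 1 + w₂ ≤ w) (hn : n₁ + n₂ ≤ n) : Computes n w E (insert f F') := by
  refine (h₁.bind (c := 1) (by simp) (h₂.mono le_rfl le_rfl ?_ subset_rfl) hw₁ hw₂ hn).mono
    le_rfl le_rfl subset_rfl subset_rfl
  rw [Set.union_comm, Set.insert_eq]

lemma bind_drop {f : X → ℝ} (h₁ : Computes n₁ w₁ E {f}) (h₂ : Computes n₂ w₂ (insert f E) F')
    (hw₁ : w₁ ≤ w) (hw₂ : 1 + w₂ ≤ w) (hn : n₁ + n₂ ≤ n) : Computes n w E F' :=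
  (h₁.bind_one h₂ hw₁ hw₂ hn).mono le_rfl le_rfl subset_rfl (Set.subset_insert _ _)

lemma of_subset (h : F ⊆ E) : Computes n w E F := by
  have : Computes 0 0 E F := fun G k hG hEG hk => Set.union_subset subset_rfl (h.trans hEG)
  exact this.mono (by omega) (by omega) subset_rfl subset_rfl

lemma relu_span {f g : X → ℝ} (hg : g ∈ Submodule.span ℝ E) (hf : ∀ x, f x = relu (g x)) :
    Computes 1 1 E {f} := by
  intro G k hG hEG hk
  refine ⟨G, subset_rfl, (Set.encard_union_le _ _).trans ?_, ?_⟩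
  · push_cast
    exact add_le_add hk (by simp)
  · rintro b (hb | rfl)
    · exact ⟨b, Submodule.subset_span hb, funext fun x => (relu_of_nonneg (hG b hb x)).symm⟩
    · exact ⟨g, Submodule.span_mono hEG hg, funext hf⟩

lemma relu_lin {f g₁ g₂ g₃ g₄ g₅ : X → ℝ} (a₁ a₂ a₃ a₄ a₅ : ℝ) (h₁ : g₁ ∈ E) (h₂ : g₂ ∈ E)
    (h₃ : g₃ ∈ E) (h₄ : g₄ ∈ E) (h₅ : g₅ ∈ E)
    (hf : ∀ x, f x = relu (a₁ * g₁ x + a₂ * g₂ x + a₃ * g₃ x + a₄ * g₄ x + a₅ * g₅ x)) :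
    Computes 1 1 E {f} := by
  refine relu_span (g := a₁ • g₁ + a₂ • g₂ + a₃ • g₃ + a₄ • g₄ + a₅ • g₅) ?_ (by simpa using hf)
  have key : ∀ (a : ℝ) {g : X → ℝ}, g ∈ E → a • g ∈ Submodule.span ℝ E := fun a g h =>
    Submodule.smul_mem _ a (Submodule.subset_span h)
  exact add_mem (add_mem (add_mem (add_mem (key _ h₁) (key _ h₂)) (key _ h₃)) (key _ h₄))
    (key _ h₅)

lemma sum {ι : Type*} (s : Finset ι) (a : ι → ℝ) (ha : ∀ i, 0 ≤ a i) (h : ι → X → ℝ)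
    (h0 : ∀ i x, 0 ≤ h i x) (h1 : (1 : X → ℝ) ∈ E) (hc : ∀ i ∈ s, Computes n w E {h i}) :
    Computes (s.card * (n + 1) + 1) (w + 3) E {fun x => ∑ i ∈ s, a i * h i x} := by
  classical
  induction s using Finset.induction_on with
  | empty =>
    exact (relu_lin 0 0 0 0 0 h1 h1 h1 h1 h1 (by simp [relu])).mono (by simp) (by omega)
      subset_rfl subset_rfl
  | insert i s hi ih =>
    rw [Finset.card_insert_of_notMem hi]
    refine bind_drop (ih fun j hj => hc j (by simp [hj]))
      (bind_drop (n := n + 1) (w := w + 2)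
        ((hc i (by simp)).mono le_rfl le_rfl (Set.subset_insert _ _) subset_rfl)
        (relu_lin (a i) 1 0 0 0 (g₁ := h i) (g₂ := fun x => ∑ i ∈ s, a i * h i x) (g₃ := 1)
          (g₄ := 1) (g₅ := 1) (by simp) (by simp) (by simp [h1]) (by simp [h1]) (by simp [h1])
          fun x => ?_)
        (by omega) (by omega) (by omega)) (by omega) (by omega) (by ring_nf; omega)
    have : 0 ≤ ∑ j ∈ insert i s, a j * h j x :=
      Finset.sum_nonneg fun j _ => mul_nonneg (ha j) (h0 j x)
    rw [Finset.sum_insert hi] at this ⊢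
    rw [relu_of_nonneg]
    · simp
    · simpa using this

end Computes

/-! ### Sawtooth functions and approximate multiplication -/

/-- The tent map on `[0, 1]`. -/
def tent (y : ℝ) : ℝ := relu (2 * y - 4 * relu (y - 1 / 2))

lemma tent_of_le {y : ℝ} (h0 : 0 ≤ y) (h : y ≤ 1 / 2) : tent y = 2 * y := by
  rw [tent, relu_of_nonpos (x := y - 1 / 2) (by linarith), relu_of_nonneg] <;> linarith

lemma tent_of_ge {y : ℝ} (h : 1 / 2 ≤ y) (h1 : y ≤ 1) : tent y = 2 - 2 * y := by
  rw [tent, relu_of_nonneg (x := y - 1 / 2) (by linarith), relu_of_nonneg] <;> linarith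

lemma tent_mem {y : ℝ} (h : y ∈ Set.Icc (0 : ℝ) 1) : tent y ∈ Set.Icc (0 : ℝ) 1 := by
  rcases le_total y (1 / 2) with h' | h'
  · rw [tent_of_le h.1 h']; constructor <;> linarith [h.1]
  · rw [tent_of_ge h' h.2]; constructor <;> linarith [h.2]

/-- The `k`-fold iterate of the tent map. -/
def saw : ℕ → ℝ → ℝ
  | 0, y => y
  | k + 1, y => tent (saw k y)

lemma saw_mem (k : ℕ) {y : ℝ} (h : y ∈ Set.Icc (0 : ℝ) 1) : saw k y ∈ Set.Icc (0 : ℝ) 1 := by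
  induction k with
  | zero => exact h
  | succ k ih => exact tent_mem ih

/-- The sawtooth approximation of `y - y ^ 2`. -/
def sawSum (m : ℕ) (y : ℝ) : ℝ := ∑ k ∈ Finset.range m, saw (k + 1) y / 4 ^ (k + 1)

lemma sub_sq_eq_tent {y : ℝ} (h : y ∈ Set.Icc (0 : ℝ) 1) :
    y - y ^ 2 = tent y / 4 + (tent y - tent y ^ 2) / 4 := by
  rcases le_total y (1 / 2) with h' | h'
  · rw [tent_of_le h.1 h']; ring
  · rw [tent_of_ge h' h.2]; ring

lemma sub_sq_eq_sawSum (m : ℕ) {y : ℝ} (h : y ∈ Set.Icc (0 : ℝ) 1) :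
    y - y ^ 2 = sawSum m y + (saw m y - saw m y ^ 2) / 4 ^ m := by
  induction m with
  | zero => simp [sawSum, saw]
  | succ m ih =>
    rw [ih, sub_sq_eq_tent (saw_mem m h), sawSum, sawSum, Finset.sum_range_succ]
    change _ = _ + tent (saw m y) / _ + (tent (saw m y) - tent (saw m y) ^ 2) / _
    rw [pow_succ]
    ring

lemma sawSum_bounds (m : ℕ) {y : ℝ} (h : y ∈ Set.Icc (0 : ℝ) 1) :
    sawSum m y ≤ y - y ^ 2 ∧ y - y ^ 2 ≤ sawSum m y + (1 / 4) ^ m / 4 := by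
  have h1 := sub_sq_eq_sawSum m h
  have h2 := saw_mem m h
  have h3 : 0 ≤ (saw m y - saw m y ^ 2) / 4 ^ m := by
    apply div_nonneg _ (by positivity); nlinarith [h2.1, h2.2]
  have h4 : (saw m y - saw m y ^ 2) / 4 ^ m ≤ (1 / 4) ^ m / 4 := by
    rw [one_div, inv_pow, div_eq_mul_inv, mul_comm, div_eq_mul_inv]
    gcongr
    nlinarith [sq_nonneg (saw m y - 1 / 2)]
  constructor <;> linarith

lemma sawSum_nonneg (m : ℕ) {y : ℝ} (h : y ∈ Set.Icc (0 : ℝ) 1) : 0 ≤ sawSum m y :=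
  Finset.sum_nonneg fun k _ => div_nonneg (saw_mem _ h).1 (by positivity)

/-- Clamping to `[0, 1]`. -/
def clamp (y : ℝ) : ℝ := relu (1 - relu (1 - y))

lemma clamp_mem (y : ℝ) : clamp y ∈ Set.Icc (0 : ℝ) 1 := by
  refine ⟨relu_nonneg _, ?_⟩
  have := relu_nonneg (1 - y)
  exact max_le (by linarith) zero_le_one

lemma clamp_of_mem {y : ℝ} (h : y ∈ Set.Icc (0 : ℝ) 1) : clamp y = y := by
  rw [clamp, relu_of_nonneg (x := 1 - y) (by linarith [h.2]), sub_sub_cancel, relu_of_nonneg h.1]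

lemma abs_clamp_sub_le {y z : ℝ} (hz : z ∈ Set.Icc (0 : ℝ) 1) : |clamp y - z| ≤ |y - z| := by
  rcases le_total y 0 with h | h
  · rw [clamp, relu_of_nonneg (x := 1 - y) (by linarith), sub_sub_cancel, relu_of_nonpos h,
      abs_of_nonpos (by linarith [hz.1]), abs_of_nonpos (by linarith [hz.1])]
    linarith
  rcases le_total y 1 with h' | h'
  · rw [clamp_of_mem ⟨h, h'⟩]
  · rw [clamp, relu_of_nonpos (x := 1 - y) (by linarith), sub_zero, relu_of_nonneg zero_le_one,
      abs_of_nonneg (by linarith [hz.2]), abs_of_nonneg (by linarith [hz.2])]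
    linarith

/-- Approximate multiplication on `[0, 1]`. -/
def mulApprox (m : ℕ) (a b : ℝ) : ℝ :=
  clamp ((a + b) / 2 - 2 * sawSum m ((a + b) / 2) + (sawSum m a + sawSum m b) / 2)

lemma abs_mulApprox_sub_le (m : ℕ) {a b : ℝ} (ha : a ∈ Set.Icc (0 : ℝ) 1)
    (hb : b ∈ Set.Icc (0 : ℝ) 1) : |mulApprox m a b - a * b| ≤ (1 / 4) ^ m := by
  have hab : (a + b) / 2 ∈ Set.Icc (0 : ℝ) 1 :=
    ⟨by linarith [ha.1, hb.1], by linarith [ha.2, hb.2]⟩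
  refine (abs_clamp_sub_le ⟨mul_nonneg ha.1 hb.1, mul_le_one₀ ha.2 hb.1 hb.2⟩).trans ?_
  have h1 := sawSum_bounds m ha
  have h2 := sawSum_bounds m hb
  have h3 := sawSum_bounds m hab
  have h4 : (0 : ℝ) ≤ (1 / 4) ^ m := by positivity
  rw [abs_le]
  constructor <;> nlinarith

lemma encard_pair_le {α : Type*} (a b : α) : ({a, b} : Set α).encard ≤ (2 : ℕ) :=
  (Set.encard_insert_le _ _).trans (by norm_num)

namespace Computes
variable {X : Type} {n w : ℕ} {E : Set (X → ℝ)}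

lemma tent {f : X → ℝ} (hf : f ∈ E) (h1 : 1 ∈ E) :
    Computes 2 2 E {fun x => tent (f x)} := by
  refine bind_drop (f := fun x => relu (f x - 1 / 2)) (n₁ := 1) (w₁ := 1) (n₂ := 1) (w₂ := 1)
    (relu_lin 1 (-1 / 2) 0 0 0 hf h1 h1 h1 h1 fun x => ?_)
    (relu_lin 2 (-4) 0 0 0 (g₁ := f) (g₂ := fun x => relu (f x - 1 / 2)) (g₃ := f) (g₄ := f)
      (g₅ := f) (by simp [hf]) (by simp) (by simp [hf]) (by simp [hf]) (by simp [hf])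
      fun x => ?_) (by omega) (by omega) (by omega)
  · congr 1; simp; ring
  · rw [PromptTF.tent]; congr 1; ring

lemma clamp {f : X → ℝ} (hf : f ∈ E) (h1 : 1 ∈ E) :
    Computes 2 2 E {fun x => clamp (f x)} := by
  refine bind_drop (f := fun x => relu (1 - f x)) (n₁ := 1) (w₁ := 1) (n₂ := 1) (w₂ := 1)
    (relu_lin (-1) 1 0 0 0 hf h1 h1 h1 h1 fun x => ?_)
    (relu_lin 1 (-1) 0 0 0 (g₁ := 1) (g₂ := fun x => relu (1 - f x)) (g₃ := f) (g₄ := f)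
      (g₅ := f) (by simp [h1]) (by simp) (by simp [hf]) (by simp [hf]) (by simp [hf])
      fun x => ?_) (by omega) (by omega) (by omega)
  · congr 1; simp; ring
  · rw [PromptTF.clamp]; congr 1; simp; ring

lemma saw (k : ℕ) {f : X → ℝ} (hf : f ∈ E) (h1 : 1 ∈ E) :
    Computes (2 * k) 3 E {fun x => saw k (f x)} := by
  induction k with
  | zero => exact of_subset (by simpa [PromptTF.saw] using hf)
  | succ k ih =>
    exact bind_drop ih (tent (f := fun x => PromptTF.saw k (f x)) (by simp) (by simp [h1]))
      (by omega) (by omega) (by omega)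

lemma sawSum (m : ℕ) {f : X → ℝ} (hf : f ∈ E) (h1 : 1 ∈ E)
    (h01 : ∀ x, f x ∈ Set.Icc (0 : ℝ) 1) :
    Computes (3 * m + 1) 5 E {fun x => PromptTF.saw m (f x), fun x => sawSum m (f x)} := by
  induction m with
  | zero =>
    refine ((relu_lin (f := fun x => PromptTF.sawSum 0 (f x)) 0 0 0 0 0 h1 h1 h1 h1 h1
      (by simp [PromptTF.sawSum, relu])).bind_one (n₂ := 0) (w₂ := 0) (of_subset
        (F := {fun x => PromptTF.saw 0 (f x)}) ?_) (by omega) (by omega) (by omega)).mono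
      le_rfl le_rfl subset_rfl ?_
    · simpa [PromptTF.saw] using Or.inr hf
    · exact (Set.pair_comm _ _).subset
  | succ m ih =>
    refine (ih.bind (c := 2) (n₂ := 3) (w₂ := 3) (encard_pair_le _ _)
      (bind_one (n₁ := 2) (w₁ := 2) (n₂ := 1) (w₂ := 1)
        (tent (f := fun x => PromptTF.saw m (f x)) (by simp) (by simp [h1]))
        (relu_lin (f := fun x => PromptTF.sawSum (m + 1) (f x)) 1 (1 / 4 ^ (m + 1)) 0 0 0
          (g₁ := fun x => PromptTF.sawSum m (f x))
          (g₂ := fun x => PromptTF.tent (PromptTF.saw m (f x))) (g₃ := 1) (g₄ := 1) (g₅ := 1)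
          (by simp) (by simp) (by simp [h1]) (by simp [h1]) (by simp [h1])
          fun x => ?_) (by omega) (by omega) (by omega))
      (by omega) (by omega) (by omega)).mono le_rfl le_rfl subset_rfl Set.subset_union_right
    have h := sawSum_nonneg (m + 1) (h01 x)
    rw [PromptTF.sawSum, Finset.sum_range_succ] at h ⊢
    change 0 ≤ _ + PromptTF.tent (PromptTF.saw m (f x)) / _ at h
    change _ + PromptTF.tent (PromptTF.saw m (f x)) / _ = _
    rw [relu_of_nonneg]
    · rw [PromptTF.sawSum]; ring
    · rw [PromptTF.sawSum]; convert h using 1; ring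

lemma mulApprox (m : ℕ) {f g : X → ℝ} (hf : f ∈ E) (hg : g ∈ E) (h1 : 1 ∈ E)
    (hf01 : ∀ x, f x ∈ Set.Icc (0 : ℝ) 1) (hg01 : ∀ x, g x ∈ Set.Icc (0 : ℝ) 1) :
    Computes (9 * m + 7) 9 E {fun x => mulApprox m (f x) (g x)} := by
  have hc : ∀ x, (f x + g x) / 2 ∈ Set.Icc (0 : ℝ) 1 := fun x =>
    ⟨by linarith [(hf01 x).1, (hg01 x).1], by linarith [(hf01 x).2, (hg01 x).2]⟩
  have key {E' : Set (X → ℝ)} {h : X → ℝ} (hh : h ∈ E') (h1 : 1 ∈ E')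
      (h01 : ∀ x, h x ∈ Set.Icc (0 : ℝ) 1) :
      Computes (3 * m + 1) 5 E' {fun x => PromptTF.sawSum m (h x)} :=
    (sawSum m hh h1 h01).mono le_rfl le_rfl subset_rfl (by simp)
  refine bind_drop (f := fun x => (f x + g x) / 2) (n₁ := 1) (w₁ := 1) (n₂ := 9 * m + 6)
    (w₂ := 8) (relu_lin (1 / 2) (1 / 2) 0 0 0 hf hg h1 h1 h1 fun x => ?_) ?_ (by omega) (by omega)
    (by omega)
  · rw [relu_of_nonneg]
    · ring
    · have := (hc x).1; simp; linarith
  refine bind_drop (n₂ := 6 * m + 5) (w₂ := 7)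
    (key (h := fun x => (f x + g x) / 2) (by simp) (by simp [h1]) hc) ?_
    (by omega) (by omega) (by omega)
  refine bind_drop (n₂ := 3 * m + 4) (w₂ := 6) (key (h := f) (by simp [hf]) (by simp [h1]) hf01) ?_
    (by omega) (by omega) (by omega)
  refine bind_drop (n₂ := 3) (w₂ := 5) (key (h := g) (by simp [hg]) (by simp [h1]) hg01) ?_
    (by omega) (by omega) (by omega)
  refine bind_drop (n₁ := 1) (n₂ := 1) (w₂ := 1) (f := fun x => relu (1 - ((f x + g x) / 2 - 2 * PromptTF.sawSum m ((f x + g x) / 2)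
      + (PromptTF.sawSum m (f x) + PromptTF.sawSum m (g x)) / 2)))
    (relu_lin 1 (-1) 2 (-1 / 2) (-1 / 2) (g₁ := 1) (g₂ := fun x => (f x + g x) / 2)
      (g₃ := fun x => PromptTF.sawSum m ((f x + g x) / 2))
      (g₄ := fun x => PromptTF.sawSum m (f x)) (g₅ := fun x => PromptTF.sawSum m (g x))
      (by simp [h1]) (by simp) (by simp) (by simp) (by simp) fun x => ?_)
    (relu_lin 1 (-1) 0 0 0 (g₁ := 1) (g₂ := fun x => relu (1 - ((f x + g x) / 2 -
      2 * PromptTF.sawSum m ((f x + g x) / 2)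
      + (PromptTF.sawSum m (f x) + PromptTF.sawSum m (g x)) / 2))) (g₃ := 1) (g₄ := 1) (g₅ := 1)
      (by simp [h1]) (by simp) (by simp [h1]) (by simp [h1]) (by simp [h1]) fun x => ?_)
    (by omega) (by omega) (by omega)
  · congr 1; simp; ring
  · rw [PromptTF.mulApprox, PromptTF.clamp]; congr 1; simp; ring

/-- A product of `[0, 1]`-valued computable functions is approximately computable. -/
lemma prod (m : ℕ) (l : List (X → ℝ)) (h1 : 1 ∈ E)
    (h01 : ∀ f ∈ l, ∀ x, f x ∈ Set.Icc (0 : ℝ) 1) (hc : ∀ f ∈ l, Computes n w E {f}) :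
    ∃ P : X → ℝ, Computes (l.length * (n + 9 * m + 7)) (w + 11) E {P} ∧
      (∀ x, P x ∈ Set.Icc (0 : ℝ) 1) ∧
      ∀ x, |P x - (l.map fun f => f x).prod| ≤ l.length * (1 / 4) ^ m := by
  induction l with
  | nil => exact ⟨1, of_subset (by simpa using h1), fun x => by simp, fun x => by simp⟩
  | cons f l ih =>
    obtain ⟨P, hP, hP01, hPe⟩ := ih (fun g hg => h01 g (by simp [hg]))
      (fun g hg => hc g (by simp [hg]))
    have hf01 := h01 f (by simp)
    refine ⟨fun x => PromptTF.mulApprox m (f x) (P x), ?_, fun x => clamp_mem _, fun x => ?_⟩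
    · refine bind_drop (n₂ := n + (9 * m + 7)) (w₂ := w + 10) hP
        (bind_drop (w := w + 10) ((hc f (by simp)).mono le_rfl le_rfl (Set.subset_insert _ _) subset_rfl)
          (mulApprox m (by simp) (by simp) (by simp [h1]) hf01 hP01) (by omega) (by omega) le_rfl)
        (by omega) (by omega) ?_
      simp only [List.length_cons]; ring_nf; rfl
    · have h2 := abs_mulApprox_sub_le m (hf01 x) (hP01 x)
      have h3 := hPe x
      have h4 : |f x * P x - f x * (l.map fun f => f x).prod| ≤ l.length * (1 / 4) ^ m := by
        rw [← mul_sub, abs_mul, abs_of_nonneg (hf01 x).1]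
        exact (mul_le_of_le_one_left (abs_nonneg _) (hf01 x).2).trans h3
      simp only [List.map_cons, List.prod_cons, List.length_cons]
      push_cast
      calc _ ≤ _ := abs_sub_le _ (f x * P x) _
        _ ≤ _ := by linarith

end Computes

/-! ### Extraction of binary digits -/

/-- A steep ramp from `0` to `1` on `[-η, 0]`. -/
def ramp (η y : ℝ) : ℝ := relu (y / η + 1) - relu (y / η)

lemma ramp_of_nonneg {η y : ℝ} (hη : 0 < η) (h : 0 ≤ y) : ramp η y = 1 := by
  have : 0 ≤ y / η := by positivity
  rw [ramp, relu_of_nonneg this, relu_of_nonneg (by linarith)]; ring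

lemma ramp_of_le {η y : ℝ} (hη : 0 < η) (h : y ≤ -η) : ramp η y = 0 := by
  have : y / η ≤ -1 := by rw [div_le_iff₀ hη]; linarith
  rw [ramp, relu_of_nonpos (by linarith), relu_of_nonpos (by linarith)]; ring

/-- Starting from `J` binary digits before the point, remove the top `i` of them. -/
def dropBits (η : ℝ) (J : ℕ) : ℕ → ℝ → ℝ
  | 0, v => v
  | i + 1, v =>
    relu (dropBits η J i v - 2 ^ (J - 1 - i) * ramp η (dropBits η J i v - 2 ^ (J - 1 - i)))

lemma ramp_bit {η φ : ℝ} (hη : 0 < η) (h0 : 0 ≤ φ) (h1 : φ ≤ 1 - η) (m q : ℕ) :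
    ramp η (((m % 2 ^ (q + 1) : ℕ) : ℝ) + φ - 2 ^ q) = (m / 2 ^ q % 2 : ℕ) := by
  rw [Nat.mod_pow_succ]
  have hlt : m % 2 ^ q < 2 ^ q := Nat.mod_lt _ (by positivity)
  rcases Nat.mod_two_eq_zero_or_one (m / 2 ^ q) with h | h
  · rw [h, ramp_of_le hη]
    · simp
    · have : ((m % 2 ^ q : ℕ) : ℝ) + 1 ≤ 2 ^ q := by exact_mod_cast hlt
      push_cast at this ⊢
      linarith
  · rw [h, ramp_of_nonneg hη]
    · simp
    · push_cast
      have : (0 : ℝ) ≤ ((m % 2 ^ q : ℕ) : ℝ) := by positivity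
      linarith

lemma dropBits_eq {η φ : ℝ} (hη : 0 < η) (h0 : 0 ≤ φ) (h1 : φ ≤ 1 - η) {J m : ℕ}
    (hm : m < 2 ^ J) {i : ℕ} (hi : i ≤ J) :
    dropBits η J i (m + φ) = ((m % 2 ^ (J - i) : ℕ) : ℝ) + φ := by
  induction i with
  | zero => rw [dropBits, Nat.sub_zero, Nat.mod_eq_of_lt hm]
  | succ i ih =>
    obtain ⟨q, rfl⟩ : ∃ q, J = i + q + 1 := ⟨J - i - 1, by omega⟩
    have e1 : i + q + 1 - i = q + 1 := by omega
    have e2 : i + q + 1 - 1 - i = q := by omega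
    have e3 : i + q + 1 - (i + 1) = q := by omega
    rw [dropBits, ih (by omega), e1, e2, e3, ramp_bit hη h0 h1, Nat.mod_pow_succ]
    have : (0 : ℝ) ≤ ((m % 2 ^ q : ℕ) : ℝ) := by positivity
    push_cast at this ⊢
    rw [relu_of_nonneg] <;> linarith

lemma dropBits_one {J m : ℕ} (hm : m < 2 ^ J) {i : ℕ} (hi : i ≤ J) :
    dropBits 1 J i m = (m % 2 ^ (J - i) : ℕ) := by
  simpa using dropBits_eq one_pos le_rfl (by norm_num) hm hi

/-- Selects `V k` from the values `V 0, …, V (n - 1)`, all bounded by `H`, at a natural number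
argument `k`. -/
def selectSum (H : ℝ) (V : ℕ → ℝ) : ℕ → ℝ → ℝ
  | 0, _ => 0
  | j + 1, y =>
    relu (selectSum H V j y + relu (V j - H * relu (y - j) - H * relu (j - y)))

lemma relu_select {H v : ℝ} (hv : 0 ≤ v) (hvH : v ≤ H) (k j : ℕ) :
    relu (v - H * relu ((k : ℝ) - j) - H * relu ((j : ℝ) - k)) = if k = j then v else 0 := by
  rcases lt_trichotomy k j with h | rfl | h
  · have : (k : ℝ) + 1 ≤ j := by exact_mod_cast h
    rw [relu_of_nonpos (x := (k : ℝ) - j) (by linarith),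
      relu_of_nonneg (x := (j : ℝ) - k) (by linarith), relu_of_nonpos, if_neg h.ne]
    nlinarith
  · rw [if_pos rfl, sub_self, relu_of_nonneg le_rfl, relu_of_nonneg] <;> linarith
  · have : (j : ℝ) + 1 ≤ k := by exact_mod_cast h
    rw [relu_of_nonpos (x := (j : ℝ) - k) (by linarith),
      relu_of_nonneg (x := (k : ℝ) - j) (by linarith), relu_of_nonpos, if_neg h.ne']
    nlinarith

lemma selectSum_natCast {H : ℝ} {V : ℕ → ℝ} (hV : ∀ j, 0 ≤ V j) (hVH : ∀ j, V j ≤ H) (n k : ℕ) :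
    selectSum H V n k = if k < n then V k else 0 := by
  induction n with
  | zero => simp [selectSum]
  | succ n ih =>
    rw [selectSum, ih, relu_select (hV n) (hVH n)]
    rcases lt_trichotomy k n with h | rfl | h
    · rw [if_pos h, if_neg h.ne, if_pos (by omega), relu_of_nonneg] <;> linarith [hV k]
    · rw [if_neg (by omega), if_pos rfl, if_pos (by omega), relu_of_nonneg] <;> linarith [hV k]
    · rw [if_neg (by omega), if_neg h.ne', if_neg (by omega), relu_of_nonneg] <;> linarith

/-- Accumulates the binary digit of `v` at the position `y` among the top `q` of `J` digits. -/
def bitSum (J : ℕ) (v y : ℝ) : ℕ → ℝ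
  | 0 => 0
  | q + 1 =>
    relu (bitSum J v y q + relu (ramp 1 (dropBits 1 J q v - 2 ^ (J - 1 - q))
      - relu (y - (J - 1 - q : ℕ)) - relu ((J - 1 - q : ℕ) - y)))

lemma bitSum_natCast {J V : ℕ} (hV : V < 2 ^ J) (k : ℕ) {q : ℕ} (hq : q ≤ J) :
    bitSum J V k q = if J - q ≤ k ∧ k < J then ((V / 2 ^ k % 2 : ℕ) : ℝ) else 0 := by
  induction q with
  | zero => rw [bitSum, if_neg (by omega)]
  | succ q ih =>
    rw [bitSum, ih (by omega), dropBits_one hV (by omega)]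
    obtain ⟨j, rfl⟩ : ∃ j, J = q + j + 1 := ⟨J - q - 1, by omega⟩
    have e1 : q + j + 1 - q = j + 1 := by omega
    have e2 : q + j + 1 - 1 - q = j := by omega
    have e3 : q + j + 1 - (q + 1) = j := by omega
    have hb := ramp_bit one_pos le_rfl (by norm_num : (0 : ℝ) ≤ 1 - 1) V j
    rw [add_zero] at hb
    have hle : ((V / 2 ^ j % 2 : ℕ) : ℝ) ≤ 1 := by
      exact_mod_cast Nat.le_of_lt_succ (Nat.mod_lt _ two_pos)
    have hs := relu_select (Nat.cast_nonneg (V / 2 ^ j % 2)) hle k j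
    rw [one_mul, one_mul] at hs
    rw [e1, e2, e3, hb, hs]
    rcases lt_trichotomy k j with h | rfl | h
    · rw [if_neg (by omega), if_neg h.ne, if_neg (by omega), relu_of_nonneg] <;> linarith
    · rw [if_neg (by omega), if_pos rfl, if_pos (by omega), zero_add,
        relu_of_nonneg (Nat.cast_nonneg _)]
    · rw [if_neg h.ne', add_zero]
      by_cases h' : k < q + j + 1
      · rw [if_pos (by omega), if_pos (by omega), relu_of_nonneg (Nat.cast_nonneg _)]
      · rw [if_neg (by omega), if_neg (by omega), relu_of_nonneg le_rfl]

/-- Reads the bit with index `y` out of a table with `2 ^ (2 * ρ)` entries, stored as `2 ^ ρ`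
numbers with `2 ^ ρ` binary digits. -/
def readBit (ρ : ℕ) (V : ℕ → ℕ) (y : ℝ) : ℝ :=
  clamp (bitSum (2 ^ ρ)
    (selectSum (2 ^ 2 ^ ρ) (fun j => V j) (2 ^ ρ)
      (relu (y / 2 ^ ρ - dropBits 1 (2 * ρ) ρ y / 2 ^ ρ)))
    (dropBits 1 (2 * ρ) ρ y) (2 ^ ρ))

lemma exists_nat_bits (n : ℕ) (b : ℕ → Bool) :
    ∃ V < 2 ^ n, ∀ k < n, V / 2 ^ k % 2 = (b k).toNat := by
  refine ⟨Nat.ofBits fun i : Fin n => b i, Nat.ofBits_lt_two_pow _, fun k hk => ?_⟩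
  rw [← Nat.toNat_testBit, Nat.testBit_ofBits_lt _ _ hk]

lemma exists_readBit (ρ : ℕ) (b : ℕ → Bool) :
    ∃ V : ℕ → ℕ, ∀ k : ℕ, k < 2 ^ (2 * ρ) → readBit ρ V k = (b k).toNat := by
  choose V hV hVb using fun i => exists_nat_bits (2 ^ ρ) fun j => b (i * 2 ^ ρ + j)
  refine ⟨V, fun k hk => ?_⟩
  have hd : dropBits 1 (2 * ρ) ρ k = (k % 2 ^ ρ : ℕ) := by
    rw [dropBits_one hk (by omega)]
    congr 3; omega
  have hk1 : k / 2 ^ ρ < 2 ^ ρ := by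
    rw [Nat.div_lt_iff_lt_mul (by positivity), ← pow_add]
    convert hk using 2; omega
  have hi : relu ((k : ℝ) / 2 ^ ρ - ((k % 2 ^ ρ : ℕ) : ℝ) / 2 ^ ρ) = (k / 2 ^ ρ : ℕ) := by
    have : (k : ℝ) / 2 ^ ρ - ((k % 2 ^ ρ : ℕ) : ℝ) / 2 ^ ρ = (k / 2 ^ ρ : ℕ) := by
      rw [← sub_div, div_eq_iff (by positivity), sub_eq_iff_eq_add]
      exact_mod_cast (Nat.div_add_mod' k (2 ^ ρ)).symm
    rw [this, relu_of_nonneg (Nat.cast_nonneg _)]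
  rw [readBit, hd, hi, selectSum_natCast (fun j => Nat.cast_nonneg _)
    (fun j => by exact_mod_cast (hV j).le), if_pos hk1, bitSum_natCast (hV _) _ le_rfl,
    if_pos ⟨by omega, Nat.mod_lt _ (by positivity)⟩, hVb _ _ (Nat.mod_lt _ (by positivity)),
    Nat.div_add_mod']
  exact clamp_of_mem (by cases b k <;> simp)

namespace Computes
variable {X : Type} {n w : ℕ} {E : Set (X → ℝ)}

lemma ramp_pair {f : X → ℝ} (η c : ℝ) (hf : f ∈ E) (h1 : 1 ∈ E) :
    Computes 2 2 E {fun x => relu ((f x - c) / η + 1), fun x => relu ((f x - c) / η)} := by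
  refine bind_one (n₁ := 1) (w₁ := 1) (n₂ := 1) (w₂ := 1)
    (relu_lin (1 / η) (-c / η + 1) 0 0 0 hf h1 h1 h1 h1 fun x => ?_)
    (relu_lin (1 / η) (-c / η) 0 0 0 (g₁ := f) (g₂ := 1) (g₃ := 1) (g₄ := 1) (g₅ := 1)
      (by simp [hf]) (by simp [h1]) (by simp [h1]) (by simp [h1]) (by simp [h1]) fun x => ?_)
    (by omega) (by omega) (by omega)
  · congr 1; simp; ring
  · congr 1; simp; ring

lemma dropBits (η : ℝ) (J i : ℕ) {f : X → ℝ} (hf : f ∈ E) (h1 : 1 ∈ E) :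
    Computes (3 * i) 4 E {fun x => dropBits η J i (f x)} := by
  induction i with
  | zero => exact of_subset (by simpa [PromptTF.dropBits] using hf)
  | succ i ih =>
    refine bind_drop (n₂ := 3) (w₂ := 3) ih ?_ (by omega) (by omega) (by omega)
    refine ((ramp_pair η (2 ^ (J - 1 - i)) (f := fun x => PromptTF.dropBits η J i (f x))
      (by simp) (by simp [h1])).bind (c := 2) (n₂ := 1) (w₂ := 1) (encard_pair_le _ _)
      (relu_lin 1 (-2 ^ (J - 1 - i)) (2 ^ (J - 1 - i)) 0 0
        (g₁ := fun x => PromptTF.dropBits η J i (f x))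
        (g₂ := fun x => relu ((PromptTF.dropBits η J i (f x) - 2 ^ (J - 1 - i)) / η + 1))
        (g₃ := fun x => relu ((PromptTF.dropBits η J i (f x) - 2 ^ (J - 1 - i)) / η))
        (g₄ := 1) (g₅ := 1)
        (by simp) (by simp) (by simp) (by simp [h1]) (by simp [h1]) fun x => ?_)
      (by omega) (by omega) le_rfl).mono le_rfl le_rfl subset_rfl Set.subset_union_right
    rw [PromptTF.dropBits, ramp]; congr 1; ring

lemma dist_pair {f : X → ℝ} (c : ℝ) (hf : f ∈ E) (h1 : 1 ∈ E) :
    Computes 2 2 E {fun x => relu (f x - c), fun x => relu (c - f x)} := by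
  refine bind_one (n₁ := 1) (w₁ := 1) (n₂ := 1) (w₂ := 1)
    (relu_lin 1 (-c) 0 0 0 hf h1 h1 h1 h1 fun x => ?_)
    (relu_lin (-1) c 0 0 0 (g₁ := f) (g₂ := 1) (g₃ := 1) (g₄ := 1) (g₅ := 1)
      (by simp [hf]) (by simp [h1]) (by simp [h1]) (by simp [h1]) (by simp [h1]) fun x => ?_)
    (by omega) (by omega) (by omega)
  · congr 1; simp; ring
  · congr 1; simp; ring

lemma selectSum (H : ℝ) (V : ℕ → ℝ) (j : ℕ) {f : X → ℝ} (hf : f ∈ E) (h1 : 1 ∈ E) :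
    Computes (4 * j + 1) 5 E {fun x => selectSum H V j (f x)} := by
  induction j with
  | zero => exact (relu_lin 0 0 0 0 0 h1 h1 h1 h1 h1
      (by simp [PromptTF.selectSum, relu])).mono le_rfl (by omega) subset_rfl subset_rfl
  | succ j ih =>
    refine bind_drop (n₂ := 4) (w₂ := 4) ih ?_ (by omega) (by omega) (by omega)
    refine ((dist_pair j (f := f) (by simp [hf]) (by simp [h1])).bind (c := 2) (n₂ := 2) (w₂ := 2)
      (encard_pair_le _ _)
      (bind_drop (n₁ := 1) (w₁ := 1) (n₂ := 1) (w₂ := 1)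
        (f := fun x => relu (V j - H * relu (f x - j) - H * relu (j - f x)))
        (relu_lin (V j) (-H) (-H) 0 0 (g₁ := 1) (g₂ := fun x => relu (f x - j))
          (g₃ := fun x => relu (j - f x)) (g₄ := 1) (g₅ := 1)
          (by simp [h1]) (by simp) (by simp) (by simp [h1]) (by simp [h1]) fun x => ?_)
        (relu_lin 1 1 0 0 0 (g₁ := fun x => PromptTF.selectSum H V j (f x))
          (g₂ := fun x => relu (V j - H * relu (f x - j) - H * relu (j - f x)))
          (g₃ := 1) (g₄ := 1) (g₅ := 1)
          (by simp) (by simp) (by simp [h1]) (by simp [h1]) (by simp [h1]) fun x => ?_)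
        (by omega) (by omega) le_rfl)
      (by omega) (by omega) le_rfl).mono le_rfl le_rfl subset_rfl Set.subset_union_right
    · congr 1; simp; ring
    · rw [PromptTF.selectSum]; congr 1; simp

lemma bitSum (J q : ℕ) {f g : X → ℝ} (hf : f ∈ E) (hg : g ∈ E) (h1 : 1 ∈ E) :
    Computes (8 * q + 1) 9 E
      {fun x => PromptTF.dropBits 1 J q (f x), fun x => bitSum J (f x) (g x) q} := by
  induction q with
  | zero =>
    refine (bind_one (n₂ := 0) (w₂ := 0) (f := fun x => PromptTF.bitSum J (f x) (g x) 0)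
      (relu_lin 0 0 0 0 0 h1 h1 h1 h1 h1 (by simp [PromptTF.bitSum, relu]))
      (of_subset (F := {fun x => PromptTF.dropBits 1 J 0 (f x)}) ?_)
      (w := 9) (by omega) (by omega) (by omega)).mono le_rfl le_rfl subset_rfl
      (Set.pair_comm _ _).subset
    simpa [PromptTF.dropBits] using Or.inr hf
  | succ q ih =>
    refine (ih.bind (c := 2) (n₂ := 8) (w₂ := 7) (encard_pair_le _ _) ?_ (by omega) (by omega)
      (by omega)).mono le_rfl le_rfl subset_rfl Set.subset_union_right
    refine ((ramp_pair 1 (2 ^ (J - 1 - q)) (f := fun x => PromptTF.dropBits 1 J q (f x))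
      (by simp) (by simp [h1])).bind (c := 2) (n₂ := 6) (w₂ := 5) (encard_pair_le _ _) ?_
      (by omega) (by omega) (by omega)).mono le_rfl le_rfl subset_rfl Set.subset_union_right
    refine bind_one (n₁ := 1) (w₁ := 1) (n₂ := 4) (w₂ := 4)
      (relu_lin 1 (-2 ^ (J - 1 - q)) (2 ^ (J - 1 - q)) 0 0
        (g₁ := fun x => PromptTF.dropBits 1 J q (f x))
        (g₂ := fun x => relu ((PromptTF.dropBits 1 J q (f x) - 2 ^ (J - 1 - q)) / 1 + 1))
        (g₃ := fun x => relu ((PromptTF.dropBits 1 J q (f x) - 2 ^ (J - 1 - q)) / 1))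
        (g₄ := 1) (g₅ := 1)
        (by simp) (by simp) (by simp) (by simp [h1]) (by simp [h1]) fun x => ?_) ?_
      (by omega) (by omega) (by omega)
    · rw [PromptTF.dropBits, ramp]; congr 1; ring
    refine ((dist_pair (J - 1 - q : ℕ) (f := g) (by simp [hg]) (by simp [h1])).bind (c := 2)
      (n₂ := 2) (w₂ := 2) (encard_pair_le _ _)
      (bind_drop (n₁ := 1) (w₁ := 1) (n₂ := 1) (w₂ := 1)
        (f := fun x => relu (ramp 1 (PromptTF.dropBits 1 J q (f x) - 2 ^ (J - 1 - q))
          - relu (g x - (J - 1 - q : ℕ)) - relu ((J - 1 - q : ℕ) - g x)))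
        (relu_lin 1 (-1) (-1) (-1) 0
          (g₁ := fun x => relu ((PromptTF.dropBits 1 J q (f x) - 2 ^ (J - 1 - q)) / 1 + 1))
          (g₂ := fun x => relu ((PromptTF.dropBits 1 J q (f x) - 2 ^ (J - 1 - q)) / 1))
          (g₃ := fun x => relu (g x - (J - 1 - q : ℕ)))
          (g₄ := fun x => relu ((J - 1 - q : ℕ) - g x)) (g₅ := 1)
          (by simp) (by simp) (by simp) (by simp) (by simp [h1]) fun x => ?_)
        (relu_lin 1 1 0 0 0 (g₁ := fun x => PromptTF.bitSum J (f x) (g x) q)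
          (g₂ := fun x => relu (ramp 1 (PromptTF.dropBits 1 J q (f x) - 2 ^ (J - 1 - q))
            - relu (g x - (J - 1 - q : ℕ)) - relu ((J - 1 - q : ℕ) - g x)))
          (g₃ := 1) (g₄ := 1) (g₅ := 1)
          (by simp) (by simp) (by simp [h1]) (by simp [h1]) (by simp [h1]) fun x => ?_)
        (by omega) (by omega) le_rfl)
      (by omega) (by omega) (by omega)).mono le_rfl le_rfl subset_rfl Set.subset_union_right
    · rw [ramp]; congr 1; ring
    · rw [PromptTF.bitSum]; congr 1; simp

lemma readBit (ρ : ℕ) (V : ℕ → ℕ) {f : X → ℝ} (hf : f ∈ E) (h1 : 1 ∈ E) :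
    Computes (20 * 2 ^ ρ) 13 E {fun x => readBit ρ V (f x)} := by
  have hρ : ρ < 2 ^ ρ := Nat.lt_two_pow_self
  refine bind_drop (n₂ := 15 * 2 ^ ρ + 2) (w₂ := 12) (dropBits 1 (2 * ρ) ρ hf h1) ?_
    (by omega) (by omega) (by omega)
  refine bind_drop (n₁ := 1) (w₁ := 1) (n₂ := 15 * 2 ^ ρ + 1) (w₂ := 11)
    (relu_lin (1 / 2 ^ ρ) (-1 / 2 ^ ρ) 0 0 0 (g₁ := f)
      (f := fun x => relu (f x / 2 ^ ρ - PromptTF.dropBits 1 (2 * ρ) ρ (f x) / 2 ^ ρ))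
      (g₂ := fun x => PromptTF.dropBits 1 (2 * ρ) ρ (f x)) (g₃ := 1) (g₄ := 1) (g₅ := 1)
      (by simp [hf]) (by simp) (by simp [h1]) (by simp [h1]) (by simp [h1]) fun x => ?_) ?_
    (by omega) (by omega) (by omega)
  · congr 1; simp; ring
  refine bind_drop (n₂ := 11 * 2 ^ ρ) (w₂ := 10)
    (selectSum (2 ^ 2 ^ ρ) (fun j => V j) (2 ^ ρ)
      (f := fun x => relu (f x / 2 ^ ρ - PromptTF.dropBits 1 (2 * ρ) ρ (f x) / 2 ^ ρ))
      (by simp) (by simp [h1])) ?_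
    (by omega) (by omega) (by omega)
  refine bind_drop (n₁ := 8 * 2 ^ ρ + 1) (w₁ := 9) (n₂ := 2) (w₂ := 2)
    ((bitSum (2 ^ ρ) (2 ^ ρ)
      (f := fun x => PromptTF.selectSum (2 ^ 2 ^ ρ) (fun j => V j) (2 ^ ρ)
        (relu (f x / 2 ^ ρ - PromptTF.dropBits 1 (2 * ρ) ρ (f x) / 2 ^ ρ)))
      (g := fun x => PromptTF.dropBits 1 (2 * ρ) ρ (f x))
      (by simp) (by simp) (by simp [h1])).mono le_rfl le_rfl subset_rfl
      (Set.subset_insert _ _))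
    (clamp (by simp) (by simp [h1])) (by omega) (by omega) ?_
  have h := Nat.one_le_two_pow (n := ρ)
  omega

end Computes

/-! ### From circuits to virtual networks and prompts -/

lemma vnetOut_congr {d : ℕ} {act : ℝ → ℝ} {Ws Ws' : ℕ → Matrix (Fin d) (Fin d) ℝ}
    (z : Fin d → ℝ) {n : ℕ} (h : ∀ ℓ, 1 ≤ ℓ → ℓ ≤ n → Ws ℓ = Ws' ℓ) :
    vnetOut d act Ws z n = vnetOut d act Ws' z n := by
  induction n with
  | zero => rfl
  | succ n ih =>
    rw [vnetOut, vnetOut, h (n + 1) (by omega) le_rfl, ih fun ℓ h1 h2 => h ℓ h1 (by omega)]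

/-- The activated output of the `n`-th layer; the input itself for `n = 0`. -/
def vnetHidden (d : ℕ) (Ws : ℕ → Matrix (Fin d) (Fin d) ℝ) (z : Fin d → ℝ) (n : ℕ) (k : Fin d) :
    ℝ :=
  if n = 0 then vnetOut d relu Ws z n k else relu (vnetOut d relu Ws z n k)

lemma vnetOut_update_succ {d : ℕ} (Ws : ℕ → Matrix (Fin d) (Fin d) ℝ) (z : Fin d → ℝ) (n : ℕ)
    (M : Matrix (Fin d) (Fin d) ℝ) :
    vnetOut d relu (Function.update Ws (n + 1) M) z (n + 1) = M.mulVec (vnetHidden d Ws z n) := by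
  rw [vnetOut, Function.update_self, vnetOut_congr z (Ws' := Ws)]
  · rfl
  · intro ℓ _ hℓ
    rw [Function.update_of_ne (by omega)]

lemma exists_vnetHidden_of_reach {X : Type} {d n : ℕ} (z : X → Fin d → ℝ) {B : Set (X → ℝ)}
    (h : Reach d n (Set.range fun k x => z x k) B) :
    ∃ Ws, B ⊆ Set.range fun k x => vnetHidden d Ws (z x) n k := by
  classical
  induction n generalizing B with
  | zero => exact ⟨fun _ => 0, h⟩
  | succ n ih =>
    obtain ⟨C, hC, hcard, hB⟩ := h
    obtain ⟨Ws, hWs⟩ := ih hC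
    have hfin : B.Finite := Set.finite_of_encard_le_coe hcard
    obtain ⟨e, he⟩ : ∃ e : Fin d → X → ℝ, B ⊆ Set.range e ∧ ∀ k, e k ∈ B ∨ e k = 0 := by
      have hc : hfin.toFinset.card ≤ Fintype.card (Fin d) := by
        rw [Fintype.card_fin, ← ENat.natCast_le_natCast, ← Set.Finite.encard_eq_coe_toFinset_card]
        exact hcard
      obtain ⟨ι⟩ : Nonempty (hfin.toFinset ↪ Fin d) :=
        Function.Embedding.nonempty_of_card_le (by simpa using hc)
      refine ⟨fun k => if hk : ∃ b, ι b = k then (hk.choose : X → ℝ) else 0, ?_, fun k => ?_⟩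
      · intro b hb
        refine ⟨ι ⟨b, by simpa using hb⟩, ?_⟩
        have hk : ∃ b', ι b' = ι ⟨b, by simpa using hb⟩ := ⟨_, rfl⟩
        simp only [dif_pos hk]
        rw [ι.injective hk.choose_spec]
      · by_cases hk : ∃ b, ι b = k
        · left
          simp only [dif_pos hk]
          exact hfin.mem_toFinset.1 hk.choose.2
        · right
          simp only [dif_neg hk]
    have hrow : ∀ k, ∃ c : Fin d → ℝ, ∀ x, e k x = relu (c ⬝ᵥ vnetHidden d Ws (z x) n) := by
      intro k
      rcases he.2 k with hk | hk
      · obtain ⟨g, hg, hgk⟩ := hB _ hk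
        obtain ⟨c, hc⟩ := (Submodule.mem_span_range_iff_exists_fun ℝ).1
          (Submodule.span_mono hWs hg)
        refine ⟨c, fun x => ?_⟩
        rw [hgk, ← hc]
        simp [dotProduct, Finset.sum_apply]
      · exact ⟨0, fun x => by simp [hk, relu]⟩
    choose M hM using hrow
    refine ⟨Function.update Ws (n + 1) (Matrix.of M), he.1.trans ?_⟩
    rintro _ ⟨k, rfl⟩
    refine ⟨k, funext fun x => ?_⟩
    change vnetHidden d _ (z x) (n + 1) k = e k x
    rw [vnetHidden, if_neg (by omega), vnetOut_update_succ, hM]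
    rfl

lemma exists_vnetOut_of_reach {X : Type} {d n L : ℕ} (z : X → Fin d → ℝ) (hz : ∀ x k, 0 ≤ z x k)
    {B : Set (X → ℝ)} (hB : B.encard ≤ d) (h : Reach d n (Set.range fun k x => z x k) B)
    (hL : n + 1 ≤ L) {g : X → ℝ} (hg : g ∈ Submodule.span ℝ B) (k : Fin d) :
    ∃ Ws, ∀ x, vnetOut d relu Ws (z x) L k = g x := by
  obtain ⟨L, rfl⟩ : ∃ l, L = l + 1 := ⟨L - 1, by omega⟩
  have h' : Reach d L (Set.range fun k x => z x k) B :=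
    h.mono_length (by rintro _ ⟨k, rfl⟩; exact fun x => hz x k) hB (by omega)
  obtain ⟨Ws, hWs⟩ := exists_vnetHidden_of_reach z h'
  obtain ⟨c, hc⟩ := (Submodule.mem_span_range_iff_exists_fun ℝ).1 (Submodule.span_mono hWs hg)
  refine ⟨Function.update Ws (L + 1) (Matrix.of fun _ => c), fun x => ?_⟩
  rw [vnetOut_update_succ, ← hc]
  simp [mulVec, dotProduct, Finset.sum_apply]

/-- The word embeddings of a prompt encoding the weight matrices `Ws 1, …, Ws L`. -/
def promptEmb {d : ℕ} (hd : 0 < d) (Ws : ℕ → Matrix (Fin d) (Fin d) ℝ) (j : ℕ) : Fin d → ℝ :=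
  if j % 2 = 0 then Pi.single ⟨j / 2 % d, Nat.mod_lt _ hd⟩ 1
  else Ws (j / 2 / d + 1) ⟨j / 2 % d, Nat.mod_lt _ hd⟩

lemma WPmat_promptEmb {d L : ℕ} (hd : 0 < d) (Ws : ℕ → Matrix (Fin d) (Fin d) ℝ) {ℓ : ℕ}
    (h1 : 1 ≤ ℓ) (hℓ : ℓ ≤ L) :
    WPmat (T := 2 * (d * L)) (fun j => promptEmb hd Ws j)
      (fun j => 2 * ((j : ℕ) / 2 / d) + 1 + (j : ℕ) % 2) ℓ = Ws ℓ := by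
  have hbound : ∀ k : Fin d, 2 * (d * (ℓ - 1) + k) + 1 < 2 * (d * L) := by
    intro k
    have : d * (ℓ - 1) + k < d * L := by
      calc d * (ℓ - 1) + k < d * (ℓ - 1) + d := by have := k.2; omega
        _ = d * (ℓ - 1 + 1) := by ring
        _ ≤ d * L := Nat.mul_le_mul_left _ (by omega)
    omega
  rw [WPmat, ← Fintype.sum_of_injective
    (fun k : Fin d => (⟨2 * (d * (ℓ - 1) + k), by have := hbound k; omega⟩ : Fin (2 * (d * L))))
    (f := fun k => vecMulVec (Pi.single k 1) (Ws ℓ k))]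
  · ext a b
    rw [Matrix.sum_apply, Finset.sum_eq_single a]
    · simp [vecMulVec]
    · intro c _ hc
      simp [vecMulVec, Pi.single_apply, hc.symm]
    · simp
  · intro a b hab
    have : 2 * (d * (ℓ - 1) + (a : ℕ)) = 2 * (d * (ℓ - 1) + (b : ℕ)) := congrArg Fin.val hab
    exact Fin.ext (by omega)
  · intro j hj
    split_ifs with hT hw
    · exfalso
      apply hj
      have h2 : (j : ℕ) % 2 = 0 := by omega
      have hdiv : (j : ℕ) / 2 / d = ℓ - 1 := by omega
      have hjd := Nat.div_add_mod ((j : ℕ) / 2) d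
      rw [hdiv] at hjd
      exact ⟨⟨(j : ℕ) / 2 % d, Nat.mod_lt _ hd⟩, Fin.ext (by simp only; omega)⟩
    · rfl
    · rfl
  · intro k
    have e1 : 2 * (d * (ℓ - 1) + (k : ℕ)) / 2 = d * (ℓ - 1) + k := by omega
    have e2 : (2 * (d * (ℓ - 1) + (k : ℕ)) + 1) / 2 = d * (ℓ - 1) + k := by omega
    have e3 : (d * (ℓ - 1) + (k : ℕ)) / d = ℓ - 1 := by
      rw [Nat.mul_add_div hd, Nat.div_eq_of_lt k.2, add_zero]
    have e4 : (d * (ℓ - 1) + (k : ℕ)) % d = k := by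
      rw [Nat.mul_add_mod, Nat.mod_eq_of_lt k.2]
    rw [dif_pos (hbound k), if_pos]
    · simp only [promptEmb, e1, e2, e3, e4]
      rw [if_pos (by omega), if_neg (by omega), Nat.sub_add_cancel h1]
    · simp only [e1, e2, e3]
      omega

lemma WPfam_promptEmb {d L : ℕ} (hd : 0 < d) (Ws : ℕ → Matrix (Fin d) (Fin d) ℝ) {ℓ : ℕ}
    (h1 : 1 ≤ ℓ) (hℓ : ℓ ≤ L) :
    WPfam (T := 2 * (d * L)) (fun j => promptEmb hd Ws j)
      (fun j => 2 * ((j : ℕ) / 2 / d) + 1 + (j : ℕ) % 2) 0 ℓ = Ws ℓ := by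
  have hcorr : WPcorr (T := 2 * (d * L)) (fun j => promptEmb hd Ws j)
      (fun j => 2 * ((j : ℕ) / 2 / d) + 1 + (j : ℕ) % 2) = 0 := by
    rw [WPcorr]
    split_ifs with hT hw
    · simp only at hw; omega
    · rfl
    · rfl
  rw [WPfam]
  split_ifs with h
  · subst h
    rw [WPone, hcorr, WPmat_promptEmb hd Ws le_rfl hℓ]
    simp
  · exact WPmat_promptEmb hd Ws h1 hℓ

/-- Under the emulation property, every network of width `d` and depth `L` with `d * d` weight
matrices is realized by a prompt of length `2 * (d * L)`. -/
lemma exists_prompt {d p L : ℕ} (hd : 0 < d) (hL : 0 < L) {forward} (hΘ : EmulatesWith d forward relu)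
    (Ws : ℕ → Matrix (Fin d) (Fin d) ℝ) :
    ∃ (S : ℝ) (u : Fin (2 * (d * L)) → Fin d → ℝ) (w : Fin (2 * (d * L)) → ℕ),
      0 < S ∧ ValidPrompt Set.univ (2 * (d * L)) L u w ∧
      ∀ x ∈ unitCube p, fhat forward u w S L p x
        = vnetOut d relu Ws (embed d p x) L ⟨0, hd⟩ := by
  set T := 2 * (d * L) with hT
  have hTpos : 0 < T := by positivity
  set u : Fin T → Fin d → ℝ := fun j => promptEmb hd Ws j with hu
  set w : Fin T → ℕ := fun j => 2 * ((j : ℕ) / 2 / d) + 1 + (j : ℕ) % 2 with hw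
  set B : ℝ := 1 + ∑ j, Real.sqrt (∑ k, u j k ^ 2) with hB
  have hB1 : 1 ≤ B := le_add_of_nonneg_right (Finset.sum_nonneg fun j _ => Real.sqrt_nonneg _)
  set S : ℝ := max ((d : ℝ) * B ^ (4 * L) * (T : ℝ) ^ (2 * L)) (2 * (L : ℝ)) with hS
  have hw' : ∀ j, 1 ≤ w j ∧ w j ≤ 2 * L := by
    intro j
    have : (j : ℕ) / 2 / d < L := by
      rw [Nat.div_lt_iff_lt_mul hd, mul_comm]
      have := j.2
      omega
    simp only [hw]
    omega
  refine ⟨S, u, w, ?_, ⟨fun _ => trivial, hw'⟩, fun x hx => ?_⟩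
  · exact lt_of_lt_of_le (by positivity) (le_max_right _ _)
  · have hz : ∀ (i : Fin 1) k, embed d p x k ∈ Set.Icc (0 : ℝ) 1 := by
      intro _ k
      rw [embed]
      split_ifs
      · exact ⟨hx.1 _, hx.2 _⟩
      · simp
      · simp
    have hball : Set.range u ⊆ eball d B := by
      rintro _ ⟨j, rfl⟩
      have := Finset.single_le_sum (f := fun j => Real.sqrt (∑ k, u j k ^ 2))
        (fun j _ => Real.sqrt_nonneg _) (Finset.mem_univ j)
      exact this.trans (by linarith)
    have key := hΘ B hB1 T L hTpos hL (Set.range u) hball S le_rfl u w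
      ⟨fun j => ⟨j, rfl⟩, hw'⟩ 1 one_pos (fun _ => embed d p x) hz 0 L hL le_rfl
    have hidx : T + 1 + L = T + 1 * L + ((0 : Fin 1) : ℕ) + 1 := by simp; omega
    rw [fhat, hidx, key, promptToken, dif_pos hd, vnetOut_congr]
    intro ℓ h1 hℓ
    exact WPfam_promptEmb hd Ws h1 hℓ

/-! ### Taylor's formula on the unit cube -/

section Taylor
variable {p : ℕ}

lemma uniqueDiffOn_unitCube (p : ℕ) : UniqueDiffOn ℝ (unitCube p) := by
  rw [unitCube, ← Set.pi_univ_Icc]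
  exact UniqueDiffOn.univ_pi fun _ => uniqueDiffOn_Icc zero_lt_one

lemma pderivW_mem_Hclass {β : ℕ} {f : (Fin p → ℝ) → ℝ} (hf : f ∈ Hclass p (β + 1)) (i : Fin p) :
    pderivW p i f ∈ Hclass p β := by
  refine ⟨?_, fun ls hls => hf.2 (i :: ls) (by simpa using hls)⟩
  exact (hf.1.fderivWithin (uniqueDiffOn_unitCube p) (by norm_cast)).clm_apply contDiffOn_const

/-- The `k`-th directional derivative of `f` at `b` in the direction `y`, expanded into partial
derivatives. -/
def dirDeriv : ℕ → ((Fin p → ℝ) → ℝ) → (Fin p → ℝ) → (Fin p → ℝ) → ℝ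
  | 0, f, b, _ => f b
  | k + 1, f, b, y => ∑ i, y i * dirDeriv k (pderivW p i f) b y

lemma dirDeriv_smul (k : ℕ) (f : (Fin p → ℝ) → ℝ) (b y : Fin p → ℝ) (τ : ℝ) :
    dirDeriv k f b (τ • y) = τ ^ k * dirDeriv k f b y := by
  induction k generalizing f with
  | zero => simp [dirDeriv]
  | succ k ih =>
    simp only [dirDeriv, ih, Finset.mul_sum, Pi.smul_apply, smul_eq_mul]
    exact Finset.sum_congr rfl fun i _ => by ring

lemma dirDeriv_eq_sum (k : ℕ) (f : (Fin p → ℝ) → ℝ) (b y : Fin p → ℝ) :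
    dirDeriv k f b y
      = ∑ ls : Fin k → Fin p, pderivList p (List.ofFn ls) f b * ∏ i, y (ls i) := by
  induction k generalizing f with
  | zero => simp [dirDeriv, pderivList]
  | succ k ih =>
    rw [dirDeriv, ← (Fin.consEquiv fun _ => Fin p).sum_comp, Fintype.sum_prod_type]
    refine Finset.sum_congr rfl fun i _ => ?_
    rw [ih, Finset.mul_sum]
    refine Finset.sum_congr rfl fun ls _ => ?_
    simp only [Fin.consEquiv_apply, List.ofFn_succ, Fin.cons_zero, Fin.cons_succ, pderivList,
      Fin.prod_univ_succ]
    ring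

lemma hasDerivWithinAt_comp_segment {f : (Fin p → ℝ) → ℝ}
    (hf : DifferentiableOn ℝ f (unitCube p)) {b y : Fin p → ℝ} {τ : ℝ}
    (hb : ∀ τ ∈ Set.Icc (0 : ℝ) 1, b + τ • y ∈ unitCube p) (hτ : τ ∈ Set.Icc (0 : ℝ) 1) :
    HasDerivWithinAt (fun τ : ℝ => f (b + τ • y)) (∑ i, y i * pderivW p i f (b + τ • y))
      (Set.Icc 0 1) τ := by
  have h1 := (hf _ (hb τ hτ)).hasFDerivWithinAt
  have h2 : HasDerivWithinAt (fun τ : ℝ => b + τ • y) y (Set.Icc 0 1) τ := by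
    simpa using ((hasDerivWithinAt_id τ (Set.Icc (0 : ℝ) 1)).smul_const y).const_add b
  have h3 := h1.comp_hasDerivWithinAt τ h2 hb
  refine h3.congr_deriv ?_
  conv_lhs => rw [← Finset.univ_sum_single y, map_sum]
  refine Finset.sum_congr rfl fun i _ => ?_
  have : (Pi.single i (y i) : Fin p → ℝ) = y i • Pi.single i 1 := by
    rw [← Pi.single_smul]; simp
  rw [this, map_smul, smul_eq_mul, pderivW, Finset.univ_sum_single]

lemma abs_sub_taylor_le {β : ℕ} {f : (Fin p → ℝ) → ℝ} (hf : f ∈ Hclass p β) {b y : Fin p → ℝ}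
    (hb : b ∈ unitCube p) (hy : b + y ∈ unitCube p) :
    |f (b + y) - ∑ k ∈ Finset.range β, dirDeriv k f b y / k.factorial| ≤ (∑ i, |y i|) ^ β := by
  induction β generalizing f y with
  | zero => simpa [pderivList] using hf.2 [] (by simp) _ hy
  | succ β ih =>
    have hseg : ∀ τ ∈ Set.Icc (0 : ℝ) 1, b + τ • y ∈ unitCube p := by
      intro τ hτ
      have := (convex_Icc (0 : Fin p → ℝ) 1).add_smul_sub_mem hb hy hτ
      rwa [add_sub_cancel_left] at this
    have hsum : 0 ≤ ∑ i, |y i| := Finset.sum_nonneg fun i _ => abs_nonneg _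
    set h : ℝ → ℝ := fun τ =>
      f (b + τ • y) - ∑ k ∈ Finset.range (β + 1), τ ^ k * (dirDeriv k f b y / k.factorial) with hh
    have hder : ∀ τ ∈ Set.Icc (0 : ℝ) 1, HasDerivWithinAt h
        (∑ i, y i * (pderivW p i f (b + τ • y)
          - ∑ k ∈ Finset.range β, dirDeriv k (pderivW p i f) b (τ • y) / k.factorial))
        (Set.Icc 0 1) τ := by
      intro τ hτ
      have h1 := hasDerivWithinAt_comp_segment (hf.1.differentiableOn (by norm_cast)) hseg hτ
      have h2 : HasDerivWithinAt (fun τ : ℝ => ∑ k ∈ Finset.range (β + 1),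
          τ ^ k * (dirDeriv k f b y / k.factorial))
          (∑ k ∈ Finset.range (β + 1), (k * τ ^ (k - 1)) * (dirDeriv k f b y / k.factorial))
          (Set.Icc 0 1) τ :=
        HasDerivWithinAt.fun_sum fun k _ =>
          ((hasDerivAt_pow k τ).mul_const _).hasDerivWithinAt
      refine (h1.sub h2).congr_deriv ?_
      simp only [mul_sub, Finset.sum_sub_distrib]
      congr 1
      rw [Finset.sum_range_succ']
      simp only [Nat.cast_zero, zero_mul, add_zero, Finset.mul_sum]
      rw [Finset.sum_comm]
      refine Finset.sum_congr rfl fun k _ => ?_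
      rw [dirDeriv, Finset.sum_div, Finset.mul_sum]
      refine Finset.sum_congr rfl fun i _ => ?_
      rw [dirDeriv_smul, Nat.factorial_succ, Nat.add_sub_cancel]
      have : (k.factorial : ℝ) ≠ 0 := by positivity
      push_cast
      field_simp
    have hbound : ∀ τ ∈ Set.Icc (0 : ℝ) 1,
        ‖∑ i, y i * (pderivW p i f (b + τ • y)
          - ∑ k ∈ Finset.range β, dirDeriv k (pderivW p i f) b (τ • y) / k.factorial)‖
          ≤ (∑ i, |y i|) ^ (β + 1) := by
      intro τ hτ
      refine (norm_sum_le _ _).trans ?_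
      rw [pow_succ', Finset.sum_mul]
      refine Finset.sum_le_sum fun i _ => ?_
      rw [norm_mul, Real.norm_eq_abs]
      refine mul_le_mul_of_nonneg_left ?_ (abs_nonneg _)
      refine (ih (pderivW_mem_Hclass hf i) (hseg τ hτ)).trans ?_
      refine pow_le_pow_left₀ (Finset.sum_nonneg fun i _ => abs_nonneg _) ?_ _
      refine Finset.sum_le_sum fun i _ => ?_
      rw [Pi.smul_apply, smul_eq_mul, abs_mul, abs_of_nonneg hτ.1]
      exact mul_le_of_le_one_left (abs_nonneg _) hτ.2
    have hmv := (convex_Icc (0 : ℝ) 1).norm_image_sub_le_of_norm_hasDerivWithin_le hder hbound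
      (Set.left_mem_Icc.2 zero_le_one) (Set.right_mem_Icc.2 zero_le_one)
    have h0 : h 0 = 0 := by
      simp only [hh, Finset.sum_range_succ']
      simp [dirDeriv]
    have h1 : h 1 = f (b + y) - ∑ k ∈ Finset.range (β + 1), dirDeriv k f b y / k.factorial := by
      simp [hh]
    rw [h0, h1] at hmv
    simpa using hmv

end Taylor

/-! ### Hat functions and grid cells on the unit interval -/

lemma tent_one_sub (y : ℝ) (h : y ∈ Set.Icc (0 : ℝ) 1) : tent (1 - y) = tent y := by
  rcases le_total y (1 / 2) with h' | h'
  · rw [tent_of_le h.1 h', tent_of_ge (by linarith) (by linarith [h.1])]; ring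
  · rw [tent_of_ge h' h.2, tent_of_le (by linarith [h.2]) (by linarith)]; ring

lemma tent_tent_fract (u : ℝ) : tent (tent (Int.fract u)) = tent (Int.fract (2 * u)) := by
  have h0 := Int.fract_nonneg u
  have h1 := Int.fract_lt_one u
  have hu : u = ⌊u⌋ + Int.fract u := (Int.floor_add_fract u).symm
  rcases lt_or_ge (Int.fract u) (1 / 2) with h | h
  · have : Int.fract (2 * u) = 2 * Int.fract u :=
      Int.fract_eq_iff.2 ⟨by linarith, by linarith, 2 * ⌊u⌋, by push_cast; linarith⟩
    rw [this, tent_of_le h0 h.le]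
  · have : Int.fract (2 * u) = 2 * Int.fract u - 1 :=
      Int.fract_eq_iff.2 ⟨by linarith, by linarith, 2 * ⌊u⌋ + 1, by push_cast; linarith⟩
    rw [this, tent_of_ge h h1.le, ← tent_one_sub _ ⟨by linarith, by linarith⟩]
    congr 1; ring

lemma saw_eq_tent_fract (n : ℕ) {x : ℝ} (hx : x ∈ Set.Icc (0 : ℝ) 1) :
    saw (n + 1) x = tent (Int.fract (2 ^ n * x)) := by
  induction n with
  | zero =>
    rcases hx.2.lt_or_eq with h | rfl
    · simp [saw, Int.fract_eq_self.2 ⟨hx.1, h⟩]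
    · rw [saw, saw, ← tent_one_sub _ (by simp)]; simp
  | succ n ih =>
    rw [saw, ih, tent_tent_fract]
    congr 2; ring

lemma one_sub_tent_fract (u : ℝ) :
    1 - tent (Int.fract u) = tent (Int.fract (u + 1 / 2)) := by
  have h0 := Int.fract_nonneg u
  have h1 := Int.fract_lt_one u
  have hu : u = ⌊u⌋ + Int.fract u := (Int.floor_add_fract u).symm
  rcases lt_or_ge (Int.fract u) (1 / 2) with h | h
  · have : Int.fract (u + 1 / 2) = Int.fract u + 1 / 2 :=
      Int.fract_eq_iff.2 ⟨by linarith, by linarith, ⌊u⌋, by linarith⟩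
    rw [this, tent_of_le h0 h.le, tent_of_ge (by linarith) (by linarith)]; ring
  · have : Int.fract (u + 1 / 2) = Int.fract u - 1 / 2 :=
      Int.fract_eq_iff.2 ⟨by linarith, by linarith, ⌊u⌋ + 1, by push_cast; linarith⟩
    rw [this, tent_of_ge h h1.le, tent_of_le (by linarith) (by linarith)]; ring

/-- The position of `x` relative to the grid of mesh `2 / 2 ^ J`, shifted by half a cell if `σ`
is true. -/
def cellPos (J : ℕ) (σ : Bool) (x : ℝ) : ℝ := (2 ^ J * x + (σ.toNat : ℝ)) / 2

/-- The index of the grid cell of `x`, exact unless `x` is close to the right end of a cell. -/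
def cell (η : ℝ) (J : ℕ) (σ : Bool) (x : ℝ) : ℝ :=
  relu (cellPos J σ x - dropBits η J J (cellPos J σ x))

/-- The left end of the `m`-th cell, truncated at `0`. -/
def gridPt (J : ℕ) (σ : Bool) (m : ℝ) : ℝ := relu ((2 * m - (σ.toNat : ℝ)) / 2 ^ J)

/-- The coordinate of `x` relative to its cell. -/
def localCoord (η : ℝ) (J : ℕ) (σ : Bool) (x : ℝ) : ℝ := relu (x - gridPt J σ (cell η J σ x))

/-- The periodic hat function vanishing at the ends of the cells. -/
def hat (J : ℕ) (σ : Bool) (x : ℝ) : ℝ := if σ then relu (1 - saw J x) else saw J x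

lemma hat_mem (J : ℕ) (σ : Bool) {x : ℝ} (hx : x ∈ Set.Icc (0 : ℝ) 1) :
    hat J σ x ∈ Set.Icc (0 : ℝ) 1 := by
  have h := saw_mem J hx
  rw [hat]
  split_ifs
  · rw [relu_of_nonneg (by linarith [h.2])]
    exact ⟨by linarith [h.2], by linarith [h.1]⟩
  · exact h

lemma hat_add_hat (J : ℕ) {x : ℝ} (hx : x ∈ Set.Icc (0 : ℝ) 1) :
    hat J true x + hat J false x = 1 := by
  simp [hat, relu_of_nonneg (x := 1 - saw J x) (by linarith [(saw_mem J hx).2])]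

lemma hat_eq_tent_fract {J : ℕ} (hJ : 0 < J) (σ : Bool) {x : ℝ} (hx : x ∈ Set.Icc (0 : ℝ) 1) :
    hat J σ x = tent (Int.fract (cellPos J σ x)) := by
  obtain ⟨n, rfl⟩ : ∃ n, J = n + 1 := ⟨J - 1, by omega⟩
  have h := saw_eq_tent_fract n hx
  cases σ with
  | false =>
    simp only [hat, cellPos, h, Bool.false_eq_true, if_false]
    congr 2; simp; ring
  | true =>
    simp only [hat, cellPos, if_true]
    rw [relu_of_nonneg (by linarith [(saw_mem (n + 1) hx).2]), h, one_sub_tent_fract]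
    congr 2; simp; ring

lemma localCoord_mem (η : ℝ) (J : ℕ) (σ : Bool) {x : ℝ} (hx : x ∈ Set.Icc (0 : ℝ) 1) :
    localCoord η J σ x ∈ Set.Icc (0 : ℝ) 1 := by
  refine ⟨relu_nonneg _, max_le ?_ zero_le_one⟩
  have : 0 ≤ gridPt J σ (cell η J σ x) := relu_nonneg _
  linarith [hx.2]

lemma exists_cell_or_hat_le {η : ℝ} (hη : 0 < η) {J : ℕ} (hJ : 0 < J) (σ : Bool) {x : ℝ}
    (hx : x ∈ Set.Icc (0 : ℝ) 1) :
    (∃ m : ℕ, m < 2 ^ J ∧ cell η J σ x = m ∧ gridPt J σ m ≤ x ∧ x - gridPt J σ m ≤ 2 / 2 ^ J) ∨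
      hat J σ x ≤ 2 * η := by
  have hσ0 : (0 : ℝ) ≤ σ.toNat := Nat.cast_nonneg _
  have hσ1 : (σ.toNat : ℝ) ≤ 1 := by exact_mod_cast Bool.toNat_le σ
  have h2 : (2 : ℝ) ≤ 2 ^ J := by
    calc (2 : ℝ) = 2 ^ 1 := by norm_num
      _ ≤ 2 ^ J := pow_le_pow_right₀ (by norm_num) hJ
  have hpos : 0 ≤ cellPos J σ x := by
    have := hx.1
    rw [cellPos]; positivity
  have hlt : cellPos J σ x < 2 ^ J := by
    rw [cellPos]; nlinarith [hx.2]
  have h0 := Int.fract_nonneg (cellPos J σ x)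
  have h1 := Int.fract_lt_one (cellPos J σ x)
  rcases le_or_gt (Int.fract (cellPos J σ x)) (1 - η) with h | h
  · left
    have hm : ((⌊cellPos J σ x⌋₊ : ℕ) : ℝ) + Int.fract (cellPos J σ x) = cellPos J σ x := by
      rw [natCast_floor_eq_intCast_floor hpos, Int.floor_add_fract]
    set m := ⌊cellPos J σ x⌋₊
    have hmJ : m < 2 ^ J := by
      have : (m : ℝ) < 2 ^ J := by linarith
      exact_mod_cast this
    have hpos' : cellPos J σ x * 2 = 2 ^ J * x + σ.toNat := by rw [cellPos]; ring
    refine ⟨m, hmJ, ?_, ?_, ?_⟩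
    · rw [cell, ← hm, dropBits_eq hη h0 h hmJ le_rfl, Nat.sub_self, pow_zero, Nat.mod_one,
        Nat.cast_zero, zero_add, add_sub_cancel_right, relu_of_nonneg (Nat.cast_nonneg _)]
    · refine max_le ?_ hx.1
      rw [div_le_iff₀ (by positivity)]
      linarith
    · have : (2 * (m : ℝ) - σ.toNat) / 2 ^ J ≤ gridPt J σ m := le_max_left _ _
      refine (sub_le_sub_left this x).trans ?_
      rw [sub_le_iff_le_add, ← add_div, le_div_iff₀ (by positivity)]
      linarith
  · right
    rw [hat_eq_tent_fract hJ σ hx, tent]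
    have := le_max_left (Int.fract (cellPos J σ x) - 1 / 2) 0
    refine max_le ?_ (by positivity)
    have h3 : Int.fract (cellPos J σ x) - 1 / 2 ≤ relu (Int.fract (cellPos J σ x) - 1 / 2) := this
    linarith

/-! ### Tables of real values -/

/-- The real number whose binary digits are stored in the bit tables `V 0, …, V (B - 1)`. -/
def readReal (ρ B : ℕ) (V : ℕ → ℕ → ℕ) (y : ℝ) : ℝ :=
  ∑ l ∈ Finset.range B, (1 / 2) ^ (l + 1) * readBit ρ (V l) y

lemma readBit_mem (ρ : ℕ) (V : ℕ → ℕ) (y : ℝ) : readBit ρ V y ∈ Set.Icc (0 : ℝ) 1 := clamp_mem _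

lemma readReal_mem (ρ B : ℕ) (V : ℕ → ℕ → ℕ) (y : ℝ) :
    readReal ρ B V y ∈ Set.Icc (0 : ℝ) 1 := by
  refine ⟨Finset.sum_nonneg fun l _ => mul_nonneg (by positivity) (readBit_mem _ _ _).1, ?_⟩
  have h : readReal ρ B V y ≤ ∑ l ∈ Finset.range B, (1 / 2 : ℝ) ^ (l + 1) :=
    Finset.sum_le_sum fun l _ => mul_le_of_le_one_right (by positivity) (readBit_mem _ _ _).2
  have h' : ∑ l ∈ Finset.range B, (1 / 2 : ℝ) ^ (l + 1) = 1 - (1 / 2) ^ B := by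
    induction B with
    | zero => simp
    | succ B ih => rw [Finset.sum_range_succ, ih (by
        exact Finset.sum_le_sum fun l _ => mul_le_of_le_one_right (by positivity)
          (readBit_mem _ _ _).2)]; ring
  have : (0 : ℝ) ≤ (1 / 2) ^ B := by positivity
  linarith

lemma exists_binary_expansion {v : ℝ} (hv : v ∈ Set.Icc (0 : ℝ) 1) (B : ℕ) :
    ∃ b : ℕ → Bool,
      |∑ l ∈ Finset.range B, (1 / 2) ^ (l + 1) * ((b l).toNat : ℝ) - v| ≤ (1 / 2) ^ B := by
  induction B generalizing v with
  | zero => exact ⟨fun _ => false, by simpa [abs_of_nonneg hv.1] using hv.2⟩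
  | succ B ih =>
    obtain ⟨c, hc⟩ : ∃ c : Bool, 2 * v - (c.toNat : ℝ) ∈ Set.Icc (0 : ℝ) 1 := by
      rcases le_total v (1 / 2) with h | h
      · exact ⟨false, by simp; constructor <;> linarith [hv.1]⟩
      · exact ⟨true, by simp; constructor <;> linarith [hv.2]⟩
    obtain ⟨b, hb⟩ := ih hc
    refine ⟨fun l => if l = 0 then c else b (l - 1), ?_⟩
    rw [Finset.sum_range_succ']
    simp only [Nat.add_eq_zero_iff, one_ne_zero, and_false, if_false, Nat.add_sub_cancel, if_true]
    have e : ∑ l ∈ Finset.range B, (1 / 2 : ℝ) ^ (l + 1 + 1) * ((b l).toNat : ℝ)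
        + (1 / 2) ^ (0 + 1) * (c.toNat : ℝ) - v
        = 1 / 2 * (∑ l ∈ Finset.range B, (1 / 2 : ℝ) ^ (l + 1) * ((b l).toNat : ℝ)
          - (2 * v - c.toNat)) := by
      rw [mul_sub, Finset.mul_sum, Finset.sum_congr rfl fun l _ =>
        show (1 / 2 : ℝ) ^ (l + 1 + 1) * ((b l).toNat : ℝ)
          = 1 / 2 * ((1 / 2) ^ (l + 1) * ((b l).toNat : ℝ)) by ring]
      ring
    rw [e, abs_mul, pow_succ', abs_of_pos (by norm_num : (0 : ℝ) < 1 / 2)]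
    exact mul_le_mul_of_nonneg_left hb (by norm_num)

lemma exists_readReal (ρ B : ℕ) {v : ℕ → ℝ} (hv : ∀ k, v k ∈ Set.Icc (0 : ℝ) 1) :
    ∃ V, ∀ k : ℕ, k < 2 ^ (2 * ρ) → |readReal ρ B V k - v k| ≤ (1 / 2) ^ B := by
  choose b hb using fun k => exists_binary_expansion (hv k) B
  choose V hV using fun l => exists_readBit ρ fun k => b k l
  refine ⟨V, fun k hk => ?_⟩
  rw [readReal, Finset.sum_congr rfl fun l _ => by rw [hV l k hk]]
  exact hb k

namespace Computes
variable {X : Type} {E : Set (X → ℝ)}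

lemma cell (η : ℝ) (J : ℕ) (σ : Bool) {f : X → ℝ} (hf : f ∈ E) (h1 : 1 ∈ E)
    (h0 : ∀ x, 0 ≤ f x) : Computes (3 * J + 2) 5 E {fun x => cell η J σ (f x)} := by
  refine bind_drop (n₁ := 1) (w₁ := 1) (n₂ := 3 * J + 1) (w₂ := 4)
    (f := fun x => cellPos J σ (f x))
    (relu_lin (2 ^ J / 2) (σ.toNat / 2) 0 0 0 hf h1 h1 h1 h1 fun x => ?_) ?_
    (by omega) (by omega) (by omega)
  · have : 0 ≤ cellPos J σ (f x) := by
      have := h0 x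
      rw [cellPos]; positivity
    rw [← relu_of_nonneg this, cellPos]
    congr 1; simp; ring
  · refine bind_drop (n₁ := 3 * J) (w₁ := 4) (n₂ := 1) (w₂ := 1)
      (dropBits η J J (f := fun x => cellPos J σ (f x)) (by simp) (by simp [h1]))
      (relu_lin 1 (-1) 0 0 0 (g₁ := fun x => cellPos J σ (f x))
        (g₂ := fun x => PromptTF.dropBits η J J (cellPos J σ (f x)))
        (g₃ := 1) (g₄ := 1) (g₅ := 1) (by simp) (by simp) (by simp [h1]) (by simp [h1])
        (by simp [h1]) fun x => ?_) (by omega) (by omega) (by omega)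
    rw [PromptTF.cell]
    congr 1; ring

lemma localCoord (η : ℝ) (J : ℕ) (σ : Bool) {f : X → ℝ} (hf : f ∈ E) (h1 : 1 ∈ E)
    (h0 : ∀ x, 0 ≤ f x) : Computes (3 * J + 4) 5 E {fun x => localCoord η J σ (f x)} := by
  refine bind_drop (n₂ := 2) (w₂ := 2) (cell η J σ hf h1 h0) ?_ (by omega) (by omega) (by omega)
  refine bind_drop (n₁ := 1) (w₁ := 1) (n₂ := 1) (w₂ := 1)
    (f := fun x => gridPt J σ (PromptTF.cell η J σ (f x)))
    (relu_lin (2 / 2 ^ J) (-σ.toNat / 2 ^ J) 0 0 0 (g₁ := fun x => PromptTF.cell η J σ (f x))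
      (g₂ := 1) (g₃ := 1) (g₄ := 1) (g₅ := 1) (by simp) (by simp [h1]) (by simp [h1])
      (by simp [h1]) (by simp [h1]) fun x => ?_)
    (relu_lin 1 (-1) 0 0 0 (g₁ := f) (g₂ := fun x => gridPt J σ (PromptTF.cell η J σ (f x)))
      (g₃ := 1) (g₄ := 1) (g₅ := 1) (by simp [hf]) (by simp) (by simp [h1]) (by simp [h1])
      (by simp [h1]) fun x => ?_) (by omega) (by omega) (by omega)
  · rw [gridPt]
    congr 1; simp; ring
  · rw [PromptTF.localCoord]
    congr 1; ring

lemma hat (J : ℕ) (σ : Bool) {f : X → ℝ} (hf : f ∈ E) (h1 : 1 ∈ E) :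
    Computes (2 * J + 1) 3 E {fun x => hat J σ (f x)} := by
  cases σ with
  | false => exact (saw J hf h1).mono (by omega) le_rfl subset_rfl (by simp [PromptTF.hat])
  | true =>
    refine bind_drop (n₂ := 1) (w₂ := 1) (saw J hf h1)
      (relu_lin (-1) 1 0 0 0 (g₁ := fun x => PromptTF.saw J (f x)) (g₂ := 1) (g₃ := 1) (g₄ := 1)
        (g₅ := 1) (by simp) (by simp [h1]) (by simp [h1]) (by simp [h1]) (by simp [h1])
        fun x => ?_) (by omega) (by omega) (by omega)
    simp only [PromptTF.hat, if_true]
    congr 1; simp; ring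

lemma readReal (ρ B : ℕ) (V : ℕ → ℕ → ℕ) {f : X → ℝ} (hf : f ∈ E) (h1 : 1 ∈ E) :
    Computes (B * (20 * 2 ^ ρ + 1) + 1) 16 E {fun x => readReal ρ B V (f x)} := by
  simpa [PromptTF.readReal] using sum (Finset.range B) (fun l => (1 / 2 : ℝ) ^ (l + 1))
    (fun l => by positivity) (fun l x => PromptTF.readBit ρ (V l) (f x))
    (fun l x => (readBit_mem _ _ _).1) h1 fun l _ => readBit ρ (V l) hf h1

end Computes

/-! ### Approximation of smooth functions by local Taylor polynomials -/

section Approximation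
variable {p : ℕ}

/-- Indices of the Taylor coefficients of order less than `β`: sequences of directions. -/
abbrev TaylorIndex (p β : ℕ) : Type := Σ k : Fin β, Fin k → Fin p

/-- The position in a table of the grid cell of `x`. -/
def cellIndex (η : ℝ) (J : ℕ) (s : Fin p → Bool) (x : Fin p → ℝ) : ℝ :=
  ∑ i : Fin p, (2 ^ J) ^ (i : ℕ) * cell η J (s i) (x i)

/-- The product hat function of the grid with shifts `s`. -/
def prodHat (J : ℕ) (s : Fin p → Bool) (x : Fin p → ℝ) : ℝ := ∏ i, hat J (s i) (x i)

/-- The monomial of index `q` in the local coordinates. -/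
def localMonomial {β : ℕ} (η : ℝ) (J : ℕ) (s : Fin p → Bool) (q : TaylorIndex p β)
    (x : Fin p → ℝ) : ℝ :=
  ∏ i, localCoord η J (s (q.2 i)) (x (q.2 i))

lemma mem_unitCube_apply {x : Fin p → ℝ} (hx : x ∈ unitCube p) (i : Fin p) :
    x i ∈ Set.Icc (0 : ℝ) 1 := ⟨hx.1 i, hx.2 i⟩

lemma prodHat_nonneg (J : ℕ) (s : Fin p → Bool) {x : Fin p → ℝ} (hx : x ∈ unitCube p) :
    0 ≤ prodHat J s x :=
  Finset.prod_nonneg fun i _ => (hat_mem J (s i) (mem_unitCube_apply hx i)).1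

lemma prodHat_le_hat (J : ℕ) (s : Fin p → Bool) {x : Fin p → ℝ} (hx : x ∈ unitCube p)
    (i : Fin p) : prodHat J s x ≤ hat J (s i) (x i) := by
  have h := fun i => hat_mem J (s i) (mem_unitCube_apply hx i)
  rw [prodHat, ← Finset.mul_prod_erase _ _ (Finset.mem_univ i)]
  exact mul_le_of_le_one_right (h i).1
    (Finset.prod_le_one (fun j _ => (h j).1) fun j _ => (h j).2)

lemma prodHat_le_one (J : ℕ) (s : Fin p → Bool) {x : Fin p → ℝ} (hx : x ∈ unitCube p) :
    prodHat J s x ≤ 1 :=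
  Finset.prod_le_one (fun i _ => (hat_mem J (s i) (mem_unitCube_apply hx i)).1)
    fun i _ => (hat_mem J (s i) (mem_unitCube_apply hx i)).2

lemma sum_prodHat (J : ℕ) {x : Fin p → ℝ} (hx : x ∈ unitCube p) :
    ∑ s : Fin p → Bool, prodHat J s x = 1 := by
  have h := Finset.prod_univ_sum (fun _ : Fin p => (Finset.univ : Finset Bool))
    fun i σ => hat J σ (x i)
  rw [Fintype.piFinset_univ] at h
  simp only [prodHat]
  rw [← h]
  refine Finset.prod_eq_one fun i _ => ?_
  rw [Fintype.sum_bool, hat_add_hat J (mem_unitCube_apply hx i)]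

lemma localMonomial_mem {β : ℕ} (η : ℝ) (J : ℕ) (s : Fin p → Bool) (q : TaylorIndex p β)
    {x : Fin p → ℝ} (hx : x ∈ unitCube p) : localMonomial η J s q x ∈ Set.Icc (0 : ℝ) 1 :=
  ⟨Finset.prod_nonneg fun _ _ => (localCoord_mem _ _ _ (mem_unitCube_apply hx _)).1,
    Finset.prod_le_one (fun _ _ => (localCoord_mem _ _ _ (mem_unitCube_apply hx _)).1)
      fun _ _ => (localCoord_mem _ _ _ (mem_unitCube_apply hx _)).2⟩

/-- The normalized partial derivatives at all grid points can be stored in bit tables. -/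
lemma exists_readReal_pderivList {β : ℕ} {f : (Fin p → ℝ) → ℝ} (hf : f ∈ Hclass p β) (r B : ℕ)
    (s : Fin p → Bool) (ls : List (Fin p)) (hls : ls.length ≤ β) :
    ∃ V, ∀ m : Fin p → ℕ, (∀ i, m i < 2 ^ (2 * r)) →
      (fun i => gridPt (2 * r) (s i) (m i)) ∈ unitCube p →
      |readReal (r * p) B V (∑ i : Fin p, (2 ^ (2 * r)) ^ (i : ℕ) * (m i : ℝ))
        - (pderivList p ls f (fun i => gridPt (2 * r) (s i) (m i)) + 1) / 2| ≤ (1 / 2) ^ B := by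
  classical
  set pt : ℕ → Fin p → ℝ := fun k i =>
    if h : k < (2 ^ (2 * r)) ^ p then
      gridPt (2 * r) (s i) (finFunctionFinEquiv.symm (⟨k, h⟩ : Fin ((2 ^ (2 * r)) ^ p)) i : ℕ)
    else 0 with hpt
  obtain ⟨V, hV⟩ := exists_readReal (r * p) B
    (v := fun k => if pt k ∈ unitCube p then (pderivList p ls f (pt k) + 1) / 2 else 0) (by
      intro k
      split_ifs with h
      · have := abs_le.1 (hf.2 ls hls _ h)
        constructor <;> linarith
      · simp)
  refine ⟨V, fun m hm hcube => ?_⟩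
  set k : Fin ((2 ^ (2 * r)) ^ p) := finFunctionFinEquiv fun i => ⟨m i, hm i⟩ with hk
  have hkval : ((k : ℕ) : ℝ) = ∑ i : Fin p, (2 ^ (2 * r)) ^ (i : ℕ) * (m i : ℝ) := by
    rw [hk, finFunctionFinEquiv_apply]
    push_cast
    exact Finset.sum_congr rfl fun i _ => mul_comm _ _
  have hptk : pt k = fun i => gridPt (2 * r) (s i) (m i) := by
    funext i
    simp only [hpt]
    rw [dif_pos k.2, Fin.eta, hk, Equiv.symm_apply_apply]
  have h := hV k (by
    refine k.2.trans_le (le_of_eq ?_)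
    rw [← pow_mul]; congr 1; ring)
  rwa [hptk, if_pos hcube, hkval] at h

/-- The local Taylor polynomials approximate `f` wherever the product hat function is not small. -/
lemma prodHat_mul_abs_sub_le {β r : ℕ} (hr : 0 < r) {f : (Fin p → ℝ) → ℝ}
    (hf : f ∈ Hclass p β) (s : Fin p → Bool) {c : TaylorIndex p β → ℝ → ℝ}
    (hc01 : ∀ q y, c q y ∈ Set.Icc (0 : ℝ) 1) {δ : ℝ} (hδ : 0 < δ)
    (hc : ∀ q, ∀ m : Fin p → ℕ, (∀ i, m i < 2 ^ (2 * r)) →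
      (fun i => gridPt (2 * r) (s i) (m i)) ∈ unitCube p →
      |c q (∑ i : Fin p, (2 ^ (2 * r)) ^ (i : ℕ) * (m i : ℝ))
        - (pderivList p (List.ofFn q.2) f (fun i => gridPt (2 * r) (s i) (m i)) + 1) / 2| ≤ δ)
    {x : Fin p → ℝ} (hx : x ∈ unitCube p) :
    prodHat (2 * r) s x * |f x - ∑ q, (2 * c q (cellIndex δ (2 * r) s x) - 1)
        * localMonomial δ (2 * r) s q x / (q.1 : ℕ).factorial|
      ≤ (p * (2 / 2 ^ (2 * r))) ^ β + 2 * Fintype.card (TaylorIndex p β) * δ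
        + 2 * δ * (1 + Fintype.card (TaylorIndex p β)) := by
  have hfac : ∀ k : ℕ, (1 : ℝ) ≤ k.factorial := fun k => by exact_mod_cast Nat.factorial_pos k
  have hterm : ∀ (q : TaylorIndex p β) (a e : ℝ), |a| ≤ e →
      |a * localMonomial δ (2 * r) s q x / (q.1 : ℕ).factorial| ≤ e := by
    intro q a e ha
    have hM := localMonomial_mem δ (2 * r) s q hx
    rw [abs_div, abs_mul, abs_of_nonneg hM.1, abs_of_nonneg (zero_le_one.trans (hfac _))]
    refine (div_le_self (mul_nonneg (abs_nonneg _) hM.1) (hfac _)).trans ?_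
    exact (mul_le_of_le_one_right (abs_nonneg _) hM.2).trans ha
  have hcell := fun i => exists_cell_or_hat_le hδ (J := 2 * r) (by omega) (s i)
    (mem_unitCube_apply hx i)
  by_cases hgood : ∀ i, ∃ m : ℕ, m < 2 ^ (2 * r) ∧ cell δ (2 * r) (s i) (x i) = m ∧
      gridPt (2 * r) (s i) m ≤ x i ∧ x i - gridPt (2 * r) (s i) m ≤ 2 / 2 ^ (2 * r)
  · choose m hm hcm hle hlt using hgood
    set b : Fin p → ℝ := fun i => gridPt (2 * r) (s i) (m i) with hb
    have hbc : b ∈ unitCube p := ⟨fun i => relu_nonneg _, fun i => (hle i).trans (hx.2 i)⟩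
    have hloc : ∀ i, localCoord δ (2 * r) (s i) (x i) = (x - b) i := by
      intro i
      rw [localCoord, hcm, relu_of_nonneg (sub_nonneg.2 (hle i))]
      rfl
    have hidx : cellIndex δ (2 * r) s x
        = ∑ i : Fin p, (2 ^ (2 * r)) ^ (i : ℕ) * (m i : ℝ) := by
      simp only [cellIndex, hcm]
    have htaylor := abs_sub_taylor_le hf hbc (y := x - b) (by simpa using hx)
    rw [add_sub_cancel] at htaylor
    have hsum : ∑ k ∈ Finset.range β, dirDeriv k f b (x - b) / k.factorial
        = ∑ q : TaylorIndex p β, pderivList p (List.ofFn q.2) f b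
          * localMonomial δ (2 * r) s q x / (q.1 : ℕ).factorial := by
      rw [Fintype.sum_sigma, Finset.sum_range]
      refine Finset.sum_congr rfl fun k _ => ?_
      rw [dirDeriv_eq_sum, Finset.sum_div]
      refine Finset.sum_congr rfl fun ls _ => ?_
      simp only [localMonomial, hloc]
    have hpow : (∑ i, |(x - b) i|) ^ β ≤ (p * (2 / 2 ^ (2 * r)) : ℝ) ^ β := by
      refine pow_le_pow_left₀ (Finset.sum_nonneg fun i _ => abs_nonneg _) ?_ _
      refine (Finset.sum_le_card_nsmul _ _ (2 / 2 ^ (2 * r)) fun i _ => ?_).trans ?_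
      · rw [abs_of_nonneg (a := (x - b) i) (sub_nonneg.2 (hle i))]
        exact hlt i
      · simp
    have hdiff : |∑ q : TaylorIndex p β, pderivList p (List.ofFn q.2) f b
          * localMonomial δ (2 * r) s q x / (q.1 : ℕ).factorial
        - ∑ q, (2 * c q (cellIndex δ (2 * r) s x) - 1)
          * localMonomial δ (2 * r) s q x / (q.1 : ℕ).factorial|
        ≤ 2 * Fintype.card (TaylorIndex p β) * δ := by
      rw [← Finset.sum_sub_distrib]
      refine (Finset.abs_sum_le_sum_abs _ _).trans ?_
      refine (Finset.sum_le_card_nsmul _ _ (2 * δ) fun q _ => ?_).trans (le_of_eq ?_)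
      · rw [← sub_div, ← sub_mul]
        refine hterm q _ _ ?_
        have := abs_le.1 (hc q m hm hbc)
        rw [hidx, abs_le]
        constructor <;> linarith
      · rw [nsmul_eq_mul, Finset.card_univ]; ring
    have h1 := abs_sub_le (f x) _ _ |>.trans (add_le_add (hsum ▸ htaylor) hdiff)
    have h2 : 0 ≤ 2 * δ * (1 + Fintype.card (TaylorIndex p β)) := by positivity
    refine (mul_le_of_le_one_left (abs_nonneg _) (prodHat_le_one _ s hx)).trans ?_
    linarith
  · obtain ⟨i, hi⟩ := not_forall.1 hgood
    have hhat := (prodHat_le_hat (2 * r) s hx i).trans ((hcell i).resolve_left hi)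
    have hfx : |f x| ≤ 1 := by simpa [pderivList] using hf.2 [] (by simp) x hx
    have hS : |∑ q, (2 * c q (cellIndex δ (2 * r) s x) - 1)
          * localMonomial δ (2 * r) s q x / (q.1 : ℕ).factorial|
        ≤ Fintype.card (TaylorIndex p β) := by
      refine (Finset.abs_sum_le_sum_abs _ _).trans ?_
      refine (Finset.sum_le_card_nsmul _ _ 1 fun q _ => ?_).trans (le_of_eq ?_)
      · refine hterm q _ _ ?_
        have := hc01 q (cellIndex δ (2 * r) s x)
        rw [abs_le]
        constructor <;> linarith [this.1, this.2]
      · rw [nsmul_eq_mul, Finset.card_univ, mul_one]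
    have h1 := (abs_sub _ _).trans (add_le_add hfx hS)
    have h2 : 0 ≤ (p * (2 / 2 ^ (2 * r)) : ℝ) ^ β + 2 * Fintype.card (TaylorIndex p β) * δ := by
      positivity
    have h3 := mul_le_mul hhat h1 (abs_nonneg _) (by positivity)
    linarith

end Approximation

/-! ### The approximating circuit -/

section Circuit
variable {p : ℕ}

/-- The constant function and the coordinate functions on the unit cube. -/
def cubeInputs (p : ℕ) : Set (unitCube p → ℝ) :=
  insert 1 (Set.range fun (i : Fin p) (x : unitCube p) => x.1 i)

lemma one_mem_cubeInputs : (1 : unitCube p → ℝ) ∈ cubeInputs p := Set.mem_insert _ _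

lemma coord_mem_cubeInputs (i : Fin p) : (fun x : unitCube p => x.1 i) ∈ cubeInputs p :=
  Set.mem_insert_of_mem _ ⟨i, rfl⟩

lemma Computes.readReal_cellIndex {δ : ℝ} (J ρ B : ℕ) (s : Fin p → Bool) (V : ℕ → ℕ → ℕ) :
    Computes (p * (3 * J + 3) + 1 + (B * (20 * 2 ^ ρ + 1) + 1)) 17 (cubeInputs p)
      {fun x => PromptTF.readReal ρ B V (cellIndex δ J s x.1)} := by
  have h : Computes (p * (3 * J + 3) + 1) 8 (cubeInputs p)
      {fun x : unitCube p => cellIndex δ J s x.1} := by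
    simpa [cellIndex] using Computes.sum (Finset.univ : Finset (Fin p))
      (fun i => ((2 : ℝ) ^ J) ^ (i : ℕ)) (fun i => by positivity)
      (fun i (x : unitCube p) => PromptTF.cell δ J (s i) (x.1 i)) (fun i x => relu_nonneg _)
      one_mem_cubeInputs fun i _ => Computes.cell δ J (s i) (coord_mem_cubeInputs i)
        one_mem_cubeInputs fun x => x.2.1 i
  exact h.bind_drop (Computes.readReal ρ B V (f := fun x : unitCube p => cellIndex δ J s x.1)
    (by simp) (Set.mem_insert_of_mem _ one_mem_cubeInputs)) (by omega) (by omega) le_rfl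

/-- A circuit for the approximate product of a product hat function, a local monomial and the
functions in `l₀`. -/
lemma exists_prod_circuit {β n : ℕ} (m : ℕ) {δ : ℝ} {J : ℕ} (hn : 3 * J + 4 ≤ n)
    (s : Fin p → Bool) (q : TaylorIndex p β) (l₀ : List (unitCube p → ℝ)) (hl₀ : l₀.length ≤ 1)
    (h01 : ∀ f ∈ l₀, ∀ x, f x ∈ Set.Icc (0 : ℝ) 1)
    (hc : ∀ f ∈ l₀, Computes n 17 (cubeInputs p) {f}) :
    ∃ P : unitCube p → ℝ, Computes ((p + β) * (n + 9 * m + 7)) 28 (cubeInputs p) {P} ∧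
      (∀ x, 0 ≤ P x) ∧
      ∀ x, |P x - (l₀.map fun f => f x).prod * prodHat J s x.1 * localMonomial δ J s q x.1|
        ≤ (p + β : ℕ) * (1 / 4) ^ m := by
  set l : List (unitCube p → ℝ) := l₀ ++ List.ofFn (fun i x => hat J (s i) (x.1 i)) ++
    List.ofFn (fun i x => localCoord δ J (s (q.2 i)) (x.1 (q.2 i))) with hl
  have hlen : l.length ≤ p + β := by
    simp only [hl, List.length_append, List.length_ofFn]
    have := q.1.2
    omega
  obtain ⟨P, hP, hP0, hPerr⟩ := Computes.prod (n := n) (w := 17) m l one_mem_cubeInputs (by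
      intro f hf x
      simp only [hl, List.mem_append, List.mem_ofFn] at hf
      obtain (hf | ⟨i, rfl⟩) | ⟨i, rfl⟩ := hf
      · exact h01 f hf x
      · exact hat_mem _ _ (mem_unitCube_apply x.2 i)
      · exact localCoord_mem _ _ _ (mem_unitCube_apply x.2 _)) (by
      intro f hf
      simp only [hl, List.mem_append, List.mem_ofFn] at hf
      obtain (hf | ⟨i, rfl⟩) | ⟨i, rfl⟩ := hf
      · exact hc f hf
      · exact (Computes.hat J (s i) (coord_mem_cubeInputs i) one_mem_cubeInputs).mono
          (by omega) (by omega) subset_rfl subset_rfl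
      · exact (Computes.localCoord δ J _ (coord_mem_cubeInputs _) one_mem_cubeInputs
          fun x => x.2.1 _).mono hn (by omega) subset_rfl subset_rfl)
  refine ⟨P, hP.mono (Nat.mul_le_mul_right _ hlen) le_rfl subset_rfl subset_rfl,
    fun x => (hP0 x).1, fun x => ?_⟩
  have h := hPerr x
  simp only [hl, List.map_append, List.prod_append, List.map_ofFn, List.prod_ofFn,
    Function.comp_apply] at h
  refine h.trans (mul_le_mul_of_nonneg_right ?_ (by positivity))
  exact_mod_cast hlen

/-- The depth of the approximating circuit. -/
def circuitDepth (p β r : ℕ) : ℕ :=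
  2 * (Fintype.card ((Fin p → Bool) × TaylorIndex p β) *
    ((p + β) * (p * (3 * (2 * r) + 3) + 1 + (2 * (r * β) * (20 * 2 ^ (r * p) + 1) + 1)
      + (3 * (2 * r) + 4) + 9 * (r * β) + 7) + 1) + 1)

/-- The constant in the approximation error of the circuit. -/
def circuitError (p β : ℕ) : ℝ :=
  Fintype.card (Fin p → Bool) * ((2 * p) ^ β + 2 * Fintype.card (TaylorIndex p β)
    + 2 * (1 + Fintype.card (TaylorIndex p β))
    + Fintype.card (TaylorIndex p β) * (3 * (p + β : ℕ)))

lemma circuitError_nonneg (p β : ℕ) : 0 ≤ circuitError p β := by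
  unfold circuitError
  positivity

theorem exists_circuit {β r : ℕ} (hr : 0 < r) {f : (Fin p → ℝ) → ℝ}
    (hf : f ∈ Hclass p β) :
    ∃ P Q : unitCube p → ℝ, Computes (circuitDepth p β r) 32 (cubeInputs p) {P, Q} ∧
      ∀ x : unitCube p, |f x.1 - (P x - Q x)| ≤ circuitError p β * (1 / 4) ^ (r * β) := by
  set δ : ℝ := (1 / 4) ^ (r * β) with hδ
  have hδ0 : 0 < δ := by positivity
  have hδ' : (1 / 2 : ℝ) ^ (2 * (r * β)) = δ := by rw [hδ, pow_mul]; norm_num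
  set n := p * (3 * (2 * r) + 3) + 1 + (2 * (r * β) * (20 * 2 ^ (r * p) + 1) + 1)
      + (3 * (2 * r) + 4) with hn
  choose V hV using fun (s : Fin p → Bool) (q : TaylorIndex p β) =>
    exists_readReal_pderivList hf r (2 * (r * β)) s (List.ofFn q.2) (by
      rw [List.length_ofFn]; exact q.1.2.le)
  rw [hδ'] at hV
  set c : (Fin p → Bool) → TaylorIndex p β → ℝ → ℝ := fun s q =>
    readReal (r * p) (2 * (r * β)) (V s q) with hc
  have hc01 : ∀ s q y, c s q y ∈ Set.Icc (0 : ℝ) 1 := fun s q y => readReal_mem _ _ _ _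
  choose P hP hP0 hPe using fun (τ : (Fin p → Bool) × TaylorIndex p β) =>
    exists_prod_circuit (n := n) (r * β) (δ := δ) (J := 2 * r) (by omega) τ.1 τ.2
      [fun x => c τ.1 τ.2 (cellIndex δ (2 * r) τ.1 x.1)] (by simp)
      (by simpa using fun x hx => hc01 τ.1 τ.2 _)
      (by simpa using (Computes.readReal_cellIndex (2 * r) (r * p) (2 * (r * β)) τ.1
            (V τ.1 τ.2)).mono (by omega) le_rfl subset_rfl subset_rfl)
  choose Q hQ hQ0 hQe using fun (τ : (Fin p → Bool) × TaylorIndex p β) =>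
    exists_prod_circuit (n := n) (r * β) (δ := δ) (J := 2 * r) (by omega) τ.1 τ.2
      [] (by simp) (by simp) (by simp)
  simp only [List.map_cons, List.map_nil, List.prod_cons, List.prod_nil, mul_one, one_mul] at hPe hQe
  have hfac : ∀ k : ℕ, (1 : ℝ) ≤ k.factorial := fun k => by exact_mod_cast Nat.factorial_pos k
  refine ⟨fun x => ∑ τ, 2 / ((τ.2.1 : ℕ).factorial : ℝ) * P τ x,
    fun x => ∑ τ, 1 / ((τ.2.1 : ℕ).factorial : ℝ) * Q τ x, ?_, fun x => ?_⟩
  · have h1 := Computes.sum Finset.univ (fun τ : (Fin p → Bool) × TaylorIndex p β =>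
      2 / ((τ.2.1 : ℕ).factorial : ℝ)) (fun τ => by positivity) P hP0 one_mem_cubeInputs
      fun τ _ => hP τ
    have h2 := Computes.sum Finset.univ (fun τ : (Fin p → Bool) × TaylorIndex p β =>
      1 / ((τ.2.1 : ℕ).factorial : ℝ)) (fun τ => by positivity) Q hQ0 one_mem_cubeInputs
      fun τ _ => hQ τ
    refine h1.bind_one (h2.mono le_rfl le_rfl (Set.subset_insert _ _) subset_rfl)
      (by omega) (by omega) ?_
    rw [circuitDepth, ← hn, Finset.card_univ]
    omega
  · have hx := x.2
    have hsplit : f x.1 - (∑ τ, 2 / ((τ.2.1 : ℕ).factorial : ℝ) * P τ x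
          - ∑ τ, 1 / ((τ.2.1 : ℕ).factorial : ℝ) * Q τ x)
        = ∑ s : Fin p → Bool, (prodHat (2 * r) s x.1 * (f x.1
            - ∑ q, (2 * c s q (cellIndex δ (2 * r) s x.1) - 1)
              * localMonomial δ (2 * r) s q x.1 / (q.1 : ℕ).factorial)
          - ∑ q : TaylorIndex p β, (2 * (P (s, q) x - c s q (cellIndex δ (2 * r) s x.1)
              * prodHat (2 * r) s x.1 * localMonomial δ (2 * r) s q x.1)
            - (Q (s, q) x - prodHat (2 * r) s x.1 * localMonomial δ (2 * r) s q x.1))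
              / (q.1 : ℕ).factorial) := by
      have hone : f x.1 = ∑ s : Fin p → Bool, prodHat (2 * r) s x.1 * f x.1 := by
        rw [← Finset.sum_mul, sum_prodHat _ hx, one_mul]
      conv_lhs => rw [hone]
      rw [Fintype.sum_prod_type, Fintype.sum_prod_type, ← Finset.sum_sub_distrib,
        ← Finset.sum_sub_distrib]
      refine Finset.sum_congr rfl fun s _ => ?_
      rw [mul_sub, sub_sub, Finset.mul_sum, ← Finset.sum_add_distrib, ← Finset.sum_sub_distrib]
      congr 1
      refine Finset.sum_congr rfl fun q _ => ?_
      ring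
    rw [hsplit]
    refine (Finset.abs_sum_le_sum_abs _ _).trans ?_
    refine (Finset.sum_le_card_nsmul _ _ (((2 * p) ^ β + 2 * Fintype.card (TaylorIndex p β)
        + 2 * (1 + Fintype.card (TaylorIndex p β))
        + Fintype.card (TaylorIndex p β) * (3 * (p + β : ℕ))) * δ) fun s _ => ?_).trans
      (le_of_eq ?_)
    · have h1 := prodHat_mul_abs_sub_le hr hf s (hc01 s) hδ0 (hV s) hx
      have h2 : |∑ q : TaylorIndex p β, (2 * (P (s, q) x - c s q (cellIndex δ (2 * r) s x.1)
              * prodHat (2 * r) s x.1 * localMonomial δ (2 * r) s q x.1)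
            - (Q (s, q) x - prodHat (2 * r) s x.1 * localMonomial δ (2 * r) s q x.1))
              / (q.1 : ℕ).factorial| ≤ Fintype.card (TaylorIndex p β) * (3 * (p + β : ℕ)) * δ := by
        refine (Finset.abs_sum_le_sum_abs _ _).trans ?_
        refine (Finset.sum_le_card_nsmul _ _ (3 * (p + β : ℕ) * δ) fun q _ => ?_).trans
          (le_of_eq ?_)
        · rw [abs_div, abs_of_nonneg (zero_le_one.trans (hfac _))]
          refine (div_le_self (abs_nonneg _) (hfac _)).trans ?_
          have h3 := abs_le.1 (hPe (s, q) x)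
          have h4 := abs_le.1 (hQe (s, q) x)
          rw [abs_le]
          constructor <;> linarith
        · rw [nsmul_eq_mul, Finset.card_univ]; ring
      have h3 : (p * (2 / 2 ^ (2 * r)) : ℝ) ^ β = (2 * p) ^ β * δ := by
        rw [hδ, pow_mul (1 / 4 : ℝ), ← mul_pow, pow_mul (2 : ℝ)]
        congr 1
        rw [one_div, inv_pow]
        norm_num
        ring
      rw [h3] at h1
      refine (abs_sub _ _).trans ?_
      rw [abs_mul, abs_of_nonneg (prodHat_nonneg _ _ hx)]
      linarith
    · rw [nsmul_eq_mul, Finset.card_univ, circuitError]; ring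

end Circuit

/-! ### Depth of the circuit against the accuracy -/

lemma exists_circuitDepth_le (p β : ℕ) :
    ∃ A : ℕ, 0 < A ∧ ∀ r, 0 < r → circuitDepth p β r + 1 ≤ A * (r * 2 ^ (r * p)) := by
  set M := Fintype.card ((Fin p → Bool) × TaylorIndex p β) with hM
  set c := 9 * p + 51 * β + 19 with hc
  refine ⟨2 * (M * ((p + β) * c + 1) + 1) + 1, by omega, fun r hr => ?_⟩
  set R := r * 2 ^ (r * p) with hR
  have h2 : 1 ≤ 2 ^ (r * p) := Nat.one_le_two_pow
  have hrR : r ≤ R := Nat.le_mul_of_pos_right r h2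
  have h1R : 1 ≤ R := Nat.succ_le_of_lt (hr.trans_le hrR)
  have hn : p * (3 * (2 * r) + 3) + 1 + (2 * (r * β) * (20 * 2 ^ (r * p) + 1) + 1)
      + (3 * (2 * r) + 4) + 9 * (r * β) + 7 ≤ c * R := by
    have e1 : p * (3 * (2 * r) + 3) ≤ p * (9 * R) := Nat.mul_le_mul_left _ (by omega)
    have e2 : β * (11 * r) ≤ β * (11 * R) := Nat.mul_le_mul_left _ (by omega)
    have e3 : 2 * (r * β) * (20 * 2 ^ (r * p) + 1) + 9 * (r * β)
        = β * (40 * R) + β * (11 * r) := by rw [hR]; ring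
    have e4 : c * R = p * (9 * R) + (β * (40 * R) + β * (11 * R)) + 19 * R := by rw [hc]; ring
    omega
  have h3 : (p + β) * (p * (3 * (2 * r) + 3) + 1 + (2 * (r * β) * (20 * 2 ^ (r * p) + 1) + 1)
      + (3 * (2 * r) + 4) + 9 * (r * β) + 7) + 1 ≤ ((p + β) * c + 1) * R := by
    have := Nat.mul_le_mul_left (p + β) hn
    nlinarith
  have h4 := Nat.mul_le_mul_left M h3
  rw [circuitDepth, ← hM]
  nlinarith

/-- The number of binary digits of the grid affordable for the accuracy `ε`. -/
lemma exists_resolution {p β A : ℕ} (hp : 0 < p) (hβ : 0 < β) (hA : 0 < A) {ε : ℝ} (hε : 0 < ε)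
    (hε1 : ε < 1) (h : 1 ≤ (1 / (2 * A : ℝ)) ^ (2 * β) / ε) :
    ∃ r : ℕ, 0 < r ∧ (1 / 4 : ℝ) ^ (r * β) ≤ (2 * A) ^ (2 * β) * ε ∧
      A * (r * 2 ^ (r * p))
        ≤ ((p : ℝ) / β) * ε ^ (-(p : ℝ) / (2 * β)) * Real.log (1 / ε) := by
  have hA1 : (1 : ℝ) ≤ A := by exact_mod_cast hA
  have hA0 : (0 : ℝ) < A := by linarith
  have hβ0 : (0 : ℝ) < β := by exact_mod_cast hβ
  have hp1 : (1 : ℝ) ≤ p := by exact_mod_cast hp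
  set e : ℝ := ε ^ (-1 / (2 * β : ℝ)) with he
  have he0 : 0 < e := Real.rpow_pos_of_pos hε _
  have hepow : e ^ (2 * β) = 1 / ε := by
    rw [he, ← Real.rpow_natCast, ← Real.rpow_mul hε.le]
    have : -1 / (2 * β : ℝ) * ((2 * β : ℕ) : ℝ) = -1 := by push_cast; field_simp
    rw [this, Real.rpow_neg_one, one_div]
  have hep : e ^ p = ε ^ (-(p : ℝ) / (2 * β)) := by
    rw [he, ← Real.rpow_natCast, ← Real.rpow_mul hε.le]
    congr 1; ring
  have hloge : Real.log e = Real.log (1 / ε) / (2 * β) := by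
    rw [he, Real.log_rpow hε, one_div, Real.log_inv]; ring
  have h2 : 2 ≤ e / A := by
    have h1 : (1 : ℝ) ≤ e / (2 * A) := by
      have h' : (1 : ℝ) ≤ (e / (2 * A)) ^ (2 * β) := by
        rw [div_pow, hepow]
        calc (1 : ℝ) ≤ _ := h
          _ = _ := by rw [one_div, inv_pow]; ring
      exact (one_le_pow_iff_of_nonneg (by positivity) (by omega)).1 h'
    rw [le_div_iff₀ (by positivity)] at h1 ⊢
    linarith
  obtain ⟨r, hr1, hr2⟩ := exists_nat_pow_near (x := e / A) (y := (2 : ℝ)) (by linarith) (by norm_num)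
  have hr : 0 < r := by
    by_contra hr
    obtain rfl : r = 0 := by omega
    norm_num at hr2
    linarith
  refine ⟨r, hr, ?_, ?_⟩
  · have h3 : (1 / 2 : ℝ) ^ r ≤ 2 * A / e := by
      rw [one_div, inv_pow, inv_le_comm₀ (by positivity) (by positivity), inv_div]
      rw [pow_succ] at hr2
      rw [div_le_iff₀ (by positivity)]
      rw [div_lt_iff₀ hA0] at hr2
      linarith
    have h4 := pow_le_pow_left₀ (by positivity) h3 (2 * β)
    rw [div_pow (2 * (A : ℝ)) e, hepow, div_div_eq_mul_div, div_one] at h4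
    refine le_trans (le_of_eq ?_) h4
    rw [← pow_mul, show r * (2 * β) = 2 * (r * β) by ring, pow_mul _ 2]
    norm_num
  · have hlog : (r : ℝ) * Real.log 2 ≤ Real.log e := by
      rw [← Real.log_pow]
      exact Real.log_le_log (by positivity) (hr1.trans (div_le_self he0.le hA1))
    have hlog2 : (1 / 2 : ℝ) ≤ Real.log 2 := by linarith [Real.log_two_gt_d9]
    have hpow : (A : ℝ) * 2 ^ (r * p) ≤ e ^ p := by
      rw [pow_mul]
      have h5 := pow_le_pow_left₀ (by positivity) hr1 p
      rw [div_pow, le_div_iff₀ (by positivity)] at h5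
      have h6 : (A : ℝ) ≤ A ^ p := le_self_pow₀ hA1 (by omega)
      have h7 : (0 : ℝ) ≤ (2 ^ r) ^ p := by positivity
      nlinarith
    have hr3 : (r : ℝ) ≤ Real.log (1 / ε) / β := by
      have : Real.log (1 / ε) / β = 2 * Real.log e := by rw [hloge]; field_simp
      rw [this]
      nlinarith [(Nat.cast_nonneg r : (0 : ℝ) ≤ r)]
    have hl0 : 0 ≤ Real.log (1 / ε) / β :=
      div_nonneg (Real.log_nonneg ((one_le_div hε).2 hε1.le)) hβ0.le
    rw [← hep]
    calc (A : ℝ) * (r * 2 ^ (r * p)) = r * (A * 2 ^ (r * p)) := by ring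
      _ ≤ (Real.log (1 / ε) / β) * e ^ p := by gcongr
      _ ≤ p * ((Real.log (1 / ε) / β) * e ^ p) :=
        le_mul_of_one_le_left (by positivity) hp1
      _ = (p / β : ℝ) * e ^ p * Real.log (1 / ε) := by ring

/-! ### Realization by a prompt -/

lemma supDist_le {p : ℕ} {f g : (Fin p → ℝ) → ℝ} {c : ℝ} (h : ∀ x ∈ unitCube p, |f x - g x| ≤ c) :
    supDist p f g ≤ c := by
  have : Nonempty (unitCube p) := ⟨⟨0, le_rfl, zero_le_one⟩⟩
  exact ciSup_le fun x => h x.1 x.2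

lemma cubeInputs_subset_embed {d p : ℕ} (hpd : p < d) :
    cubeInputs p ⊆ Set.range fun (k : Fin d) (x : unitCube p) => embed d p x.1 k := by
  rintro _ (rfl | ⟨i, rfl⟩)
  · exact ⟨⟨p, hpd⟩, funext fun x => by simp [embed]⟩
  · exact ⟨⟨i, i.2.trans hpd⟩, funext fun x => by simp [embed]⟩

lemma encard_cubeInputs_le (p : ℕ) : (cubeInputs p).encard ≤ (p + 1 : ℕ) := by
  refine (Set.encard_insert_le _ _).trans ?_
  have : (Set.range fun (i : Fin p) (x : unitCube p) => x.1 i).encard ≤ p := by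
    rw [← Set.image_univ]
    exact (Set.encard_image_le _ _).trans (by simp)
  push_cast
  gcongr

lemma embed_nonneg {d p : ℕ} {x : Fin p → ℝ} (hx : x ∈ unitCube p) (k : Fin d) :
    0 ≤ embed d p x k := by
  rw [embed]
  split_ifs
  · exact hx.1 _
  · exact zero_le_one
  · exact le_rfl

lemma exists_vnetOut_of_computes {d p n w L : ℕ} (hd : p + 1 + w ≤ d) (hd2 : 2 ≤ d)
    {P Q : unitCube p → ℝ} (h : Computes n w (cubeInputs p) {P, Q}) (hL : n + 1 ≤ L) (k : Fin d) :
    ∃ Ws, ∀ x : unitCube p, vnetOut d relu Ws (embed d p x.1) L k = P x - Q x := by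
  have hpos : ∀ g ∈ cubeInputs p, 0 ≤ g := by
    rintro _ (rfl | ⟨i, rfl⟩)
    · exact zero_le_one
    · exact fun x => x.2.1 i
  have h0 : Reach d 0 (Set.range fun (k : Fin d) (x : unitCube p) => embed d p x.1 k)
      (cubeInputs p) := cubeInputs_subset_embed (by omega)
  have h1 := h0.trans ((h _ _ hpos subset_rfl (encard_cubeInputs_le p)).mono_width hd)
  rw [zero_add] at h1
  refine exists_vnetOut_of_reach (B := {P, Q}) (g := P - Q) _ (fun x k => embed_nonneg x.2 k)
    ((encard_pair_le P Q).trans (by exact_mod_cast hd2))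
    (h1.mono_right Set.subset_union_right) hL ?_ k
  exact sub_mem (Submodule.subset_span (by simp)) (Submodule.subset_span (by simp))

end PromptTF
end

/-- There is a universal constant `c_L > 0` such that for all `p, β ∈ ℕ+` and
`d ≥ 1 + 17·β^{p+1}·3^p·p` there is `C > 0` (depending only on `β, p, d`) such that for any
transformer with the emulation property, any `ε ∈ (0,1)`, any inference depth
`L ≥ c_L·(p + β² + (p/β)·ε^{−p/(2β)}·log(1/ε))` and any prompt-length budget `T ≥ 2dL`,
every `f ∈ C_u^β([0,1]^p)` is approximated within `C·ε` by some prompt in `Q_{ℝ^d}(T,L,S)`. -/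
theorem statement_8 :
    ∃ cL : ℝ, 0 < cL ∧
      ∀ p β : ℕ, 0 < p → 0 < β →
      ∀ d : ℕ, 1 + 17 * β ^ (p + 1) * 3 ^ p * p ≤ d →
      ∃ C : ℝ, 0 < C ∧
        ∀ Θ : List (TFLayer (4 * d + 8)), EmulatesWith d (tfForward Θ) relu →
        ∀ ε : ℝ, 0 < ε → ε < 1 →
        ∀ L : ℕ,
          cL * ((p : ℝ) + (β : ℝ) ^ 2
              + ((p : ℝ) / (β : ℝ)) * ε ^ (-(p : ℝ) / (2 * (β : ℝ))) * Real.log (1 / ε))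
            ≤ (L : ℝ) →
        ∀ T : ℕ, 2 * d * L ≤ T →
        ∀ f ∈ Hclass p β, ∀ δ : ℝ, 0 < δ →
          ∃ (S : ℝ) (T' : ℕ) (u : Fin T' → Fin d → ℝ) (w : Fin T' → ℕ),
            0 < S ∧ 1 ≤ T' ∧ T' ≤ T ∧ ValidPrompt Set.univ T' L u w ∧
            supDist p f (fhat (tfForward Θ) u w S L p) ≤ C * ε + δ := by
  refine ⟨1, one_pos, fun p β hp hβ d hd => ?_⟩
  obtain ⟨A, hA, hdepth⟩ := exists_circuitDepth_le p β
  have hA0 : (0 : ℝ) < A := by exact_mod_cast hA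
  have herr := circuitError_nonneg p β
  refine ⟨(circuitError p β + 1) * (2 * A) ^ (2 * β), by positivity,
    fun Θ hΘ ε hε hε1 L hL T hT f hf δ hδ => ?_⟩
  have hpd : p + 1 + 32 ≤ d := by
    have h1 : 1 ≤ β ^ (p + 1) := Nat.one_le_pow _ _ hβ
    have h2 : 3 ^ 1 ≤ 3 ^ p := Nat.pow_le_pow_right (by norm_num) hp
    have h3 : 17 * 1 * 3 ^ 1 * p ≤ 17 * β ^ (p + 1) * 3 ^ p * p := by gcongr
    omega
  have hd0 : 0 < d := by omega
  have hp0 : (0 : ℝ) < p := by exact_mod_cast hp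
  have hsize : ((p : ℝ) / β) * ε ^ (-(p : ℝ) / (2 * β)) * Real.log (1 / ε) < L := by
    nlinarith [sq_nonneg (β : ℝ)]
  have hL0 : 0 < L := by
    have h1 : 0 ≤ Real.log (1 / ε) := Real.log_nonneg (by rw [le_div_iff₀ hε]; linarith)
    have h2 : (0 : ℝ) < L := lt_of_le_of_lt (by positivity) hsize
    exact_mod_cast h2
  suffices h : ∃ Ws, ∀ x ∈ unitCube p, |f x - vnetOut d relu Ws (embed d p x) L ⟨0, hd0⟩|
      ≤ (circuitError p β + 1) * (2 * A) ^ (2 * β) * ε by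
    obtain ⟨Ws, hWs⟩ := h
    obtain ⟨S, u, w, hS, hvalid, hfhat⟩ := exists_prompt (p := p) hd0 hL0 hΘ Ws
    refine ⟨S, 2 * (d * L), u, w, hS, ?_, by linarith, hvalid, ?_⟩
    · have := Nat.mul_pos hd0 hL0
      omega
    · refine (supDist_le fun x hx => ?_).trans (le_add_of_nonneg_right hδ.le)
      rw [hfhat x hx]
      exact hWs x hx
  by_cases h : 1 ≤ (1 / (2 * A : ℝ)) ^ (2 * β) / ε
  · obtain ⟨r, hr, hacc, hcost⟩ := exists_resolution hp hβ hA hε hε1 h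
    obtain ⟨P, Q, hPQ, hfPQ⟩ := exists_circuit hr hf
    have hnL : circuitDepth p β r + 1 ≤ L := by
      have h1 : ((A * (r * 2 ^ (r * p)) : ℕ) : ℝ) ≤ L := by push_cast; linarith
      exact (hdepth r hr).trans (by exact_mod_cast h1)
    obtain ⟨Ws, hWs⟩ := exists_vnetOut_of_computes hpd (by omega) hPQ hnL ⟨0, hd0⟩
    refine ⟨Ws, fun x hx => ?_⟩
    rw [hWs ⟨x, hx⟩]
    refine (hfPQ ⟨x, hx⟩).trans ?_
    rw [mul_assoc]
    gcongr
    linarith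
  · refine ⟨fun _ => 0, fun x hx => ?_⟩
    obtain ⟨l, rfl⟩ := Nat.exists_eq_succ_of_ne_zero hL0.ne'
    have hfx : |f x| ≤ 1 := hf.2 [] (Nat.zero_le _) x hx
    have h1 : (1 : ℝ) ≤ (2 * A) ^ (2 * β) * ε := by
      rw [not_le, div_lt_one hε, one_div, inv_pow, inv_lt_iff_one_lt_mul₀ (by positivity)] at h
      linarith
    simp only [vnetOut, zero_mulVec, Pi.zero_apply, sub_zero]
    nlinarith
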